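/- arXiv:1002.0352 — 2 statements merged into one kernel-verified Lean document; each statement's English description precedes it below -/
import Mathlib

section
/- The Riemann xi function takes values both greater than zero and less than zero on the critical line: there exist real numbers t₁ and t₂ such that the real part of ξ(1/2 + it₁) is strictly positive and the real part of ξ(1/2 + it₂) is strictly negative. -/
noncomputable def riemannXi (s : ℂ) : ℂ := s * (1 - s) / 2 * completedRiemannZeta s

section XiAux
open Complex Set MeasureTheory Filter Topology Asymptotics

lemma xiaux_integrable {σ : ℝ} (hσ : 0 < σ) {p : ℝ} (hp : 0 < p) :
    IntegrableOn (fun t : ℝ => t ^ (σ - 1) * Real.exp (-(p * t))) (Ioi 0) := by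
  have h := Real.integral_rpow_mul_exp_neg_mul_Ioi hσ hp
  by_contra hc
  rw [integral_undef hc] at h
  have : 0 < (1 / p) ^ σ * Real.Gamma σ :=
    mul_pos (Real.rpow_pos_of_pos (by positivity) _) (Real.Gamma_pos_of_pos hσ)
  linarith

lemma xiaux_gamma {σ : ℝ} (hσ : 0 < σ) {r : ℂ} (hr : 0 < r.re) :
    ∫ t : ℝ in Ioi 0, (t : ℂ) ^ ((σ : ℂ) - 1) * cexp (-(r * t)) = r ^ (-(σ : ℂ)) * Gamma σ := by
  have hmeas : Measurable (fun t : ℝ => ENNReal.ofReal (t ^ (σ - 1))) := by fun_prop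
  set μ : Measure ℝ := (volume.restrict (Ioi 0)).withDensity
    (fun t : ℝ => ENNReal.ofReal (t ^ (σ - 1))) with hμ
  have hlt : ∀ᵐ t ∂(volume.restrict (Ioi (0 : ℝ))), ENNReal.ofReal (t ^ (σ - 1)) < ⊤ :=
    Eventually.of_forall fun t => ENNReal.ofReal_lt_top
  have hF : ∀ z : ℂ, ProbabilityTheory.complexMGF (fun t : ℝ => -t) μ z =
      ∫ t : ℝ in Ioi 0, (t : ℂ) ^ ((σ : ℂ) - 1) * cexp (-(z * t)) := by
    intro z
    rw [ProbabilityTheory.complexMGF, hμ, integral_withDensity_eq_integral_toReal_smul hmeas hlt]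
    refine setIntegral_congr_fun measurableSet_Ioi fun t (ht : 0 < t) => ?_
    rw [ENNReal.toReal_ofReal (by positivity), real_smul, ofReal_cpow ht.le]
    push_cast
    ring_nf
  have hset : Ioi 0 ⊆ ProbabilityTheory.integrableExpSet (fun t : ℝ => -t) μ := by
    intro p (hp : 0 < p)
    rw [ProbabilityTheory.integrableExpSet, mem_ofPred_eq, hμ,
      integrable_withDensity_iff_integrable_smul' hmeas hlt]
    refine (xiaux_integrable hσ hp).congr_fun (fun t (ht : 0 < t) => ?_) measurableSet_Ioi
    dsimp only
    rw [ENNReal.toReal_ofReal (by positivity), smul_eq_mul]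
    ring_nf
  have hint : Ioi 0 ⊆ interior (ProbabilityTheory.integrableExpSet (fun t : ℝ => -t) μ) :=
    interior_maximal hset isOpen_Ioi
  have hU : IsOpen {z : ℂ | 0 < z.re} := isOpen_lt continuous_const continuous_re
  have hUc : IsPreconnected {z : ℂ | 0 < z.re} := (convex_halfSpace_re_gt 0).isPreconnected
  have hA : AnalyticOnNhd ℂ (ProbabilityTheory.complexMGF (fun t : ℝ => -t) μ)
      {z : ℂ | 0 < z.re} := fun z hz => ProbabilityTheory.analyticAt_complexMGF (hint hz)
  have hB : AnalyticOnNhd ℂ (fun z : ℂ => z ^ (-(σ : ℂ)) * Gamma σ) {z : ℂ | 0 < z.re} := by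
    refine DifferentiableOn.analyticOnNhd (fun z hz => ?_) hU
    refine DifferentiableAt.differentiableWithinAt ?_
    have : z ∈ slitPlane := Or.inl hz
    fun_prop (disch := assumption)
  have hseq : Tendsto (fun n : ℕ => ((1 + 1 / ((n : ℝ) + 1) : ℝ) : ℂ)) atTop (𝓝[≠] 1) := by
    refine tendsto_nhdsWithin_iff.mpr ⟨?_, Eventually.of_forall fun n => ?_⟩
    · have := (tendsto_one_div_add_atTop_nhds_zero_nat (𝕜 := ℝ)).const_add 1
      rw [add_zero] at this
      have h2 := (continuous_ofReal.tendsto (1 : ℝ)).comp this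
      rw [ofReal_one] at h2
      exact h2
    · have : (0 : ℝ) < 1 / ((n : ℝ) + 1) := by positivity
      simp only [mem_compl_iff, mem_singleton_iff]
      intro h
      rw [← ofReal_one, ofReal_inj] at h
      linarith
  have hfreq : ∃ᶠ z in 𝓝[≠] (1 : ℂ), ProbabilityTheory.complexMGF (fun t : ℝ => -t) μ z =
      z ^ (-(σ : ℂ)) * Gamma σ := by
    refine hseq.frequently (Frequently.of_forall fun n => ?_)
    have hp : 0 < (1 + 1 / ((n : ℝ) + 1) : ℝ) := by positivity
    rw [hF, Complex.integral_cpow_mul_exp_neg_mul_Ioi (by simpa using hσ) hp, one_div, inv_cpow,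
      cpow_neg]
    rw [arg_ofReal_of_nonneg hp.le]; exact Real.pi_pos.ne
  have := hA.eqOn_of_preconnected_of_frequently_eq hB hUc (by simp : (1 : ℂ) ∈ {z : ℂ | 0 < z.re})
    hfreq hr
  rw [← hF]; exact this

lemma xiaux_mul_cpow {r : ℝ} (hr : 0 < r) {z : ℂ} (hz : z ≠ 0) (s : ℂ) :
    ((r : ℂ) * z) ^ s = (r : ℂ) ^ s * z ^ s := by
  have hr' : (r : ℂ) ≠ 0 := ofReal_ne_zero.mpr hr.ne'
  rw [cpow_def_of_ne_zero (mul_ne_zero hr' hz), cpow_def_of_ne_zero hr', cpow_def_of_ne_zero hz,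
    log_ofReal_mul hr hz, ← exp_add, ofReal_log hr.le]
  ring_nf

/-- The theta function in the right half plane, along the ray through `z`. -/
noncomputable def xiTh (z : ℂ) (x : ℝ) : ℂ := jacobiTheta (I * z * x)

lemma xiaux_im (z : ℂ) (x : ℝ) : (I * z * x).im = z.re * x := by simp

lemma xiaux_th_cont {z : ℂ} (hz : 0 < z.re) {x : ℝ} (hx : 0 < x) : ContinuousAt (xiTh z) x := by
  have h : ContinuousAt jacobiTheta (I * z * x) :=
    continuousAt_jacobiTheta (by rw [xiaux_im]; positivity)
  exact ContinuousAt.comp (f := fun x : ℝ => I * z * x) h (by fun_prop)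

lemma xiaux_th_top {z : ℂ} (hz : 0 < z.re) (r : ℝ) :
    (fun x => xiTh z x - 1) =O[atTop] (fun x : ℝ => x ^ r) := by
  have ht : Tendsto (fun x : ℝ => I * z * x) atTop (comap im atTop) := by
    rw [tendsto_comap_iff]
    have : im ∘ (fun x : ℝ => I * z * x) = fun x => z.re * x := by
      ext x; exact xiaux_im z x
    rw [this]
    exact tendsto_id.const_mul_atTop hz
  have h1 := isBigO_at_im_infty_jacobiTheta_sub_one.comp_tendsto ht
  have h2 : ((fun τ : ℂ => Real.exp (-Real.pi * τ.im)) ∘ fun x : ℝ => I * z * x) =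
      fun x => Real.exp (-(Real.pi * z.re) * x) := by
    ext x
    simp only [Function.comp_apply, xiaux_im]
    ring_nf
  rw [h2] at h1
  exact h1.trans (isLittleO_exp_neg_mul_rpow_atTop (by positivity) r).isBigO

lemma xiaux_inv_re {z : ℂ} (hz : 0 < z.re) : 0 < (z⁻¹).re := by
  rw [inv_re]
  have : z ≠ 0 := by rintro rfl; simp at hz
  have := normSq_pos.mpr this
  positivity

lemma xiaux_feq {z : ℂ} (hz : 0 < z.re) {x : ℝ} (hx : 0 < x) :
    xiTh z (1 / x) = (z ^ (-(1 / 2) : ℂ) * ((x ^ (1 / 2 : ℝ) : ℝ) : ℂ)) * xiTh z⁻¹ x := by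
  have hz0 : z ≠ 0 := by rintro rfl; simp at hz
  have hx0 : (x : ℂ) ≠ 0 := ofReal_ne_zero.mpr hx.ne'
  unfold xiTh
  rw [jacobiTheta_eq_jacobiTheta₂, jacobiTheta_eq_jacobiTheta₂, jacobiTheta₂_functional_equation]
  have e1 : -I * (I * z * ((1 / x : ℝ) : ℂ)) = ((x⁻¹ : ℝ) : ℂ) * z := by
    rw [one_div]
    linear_combination (-z * ((x⁻¹ : ℝ) : ℂ)) * I_mul_I
  have e2 : -1 / (I * z * ((1 / x : ℝ) : ℂ)) = I * z⁻¹ * x := by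
    push_cast
    field_simp
    rw [I_sq]
  rw [e1, e2, xiaux_mul_cpow (by positivity) hz0, ← ofReal_one, ← ofReal_ofNat, ← ofReal_div,
    ← ofReal_cpow (by positivity), ← ofReal_neg, Real.inv_rpow hx.le]
  rw [cpow_neg]
  push_cast
  simp only [zero_div, ne_eq, OfNat.ofNat_ne_zero, not_false_eq_true, zero_pow, mul_zero, exp_zero]
  simp only [mul_one, mul_inv, one_div, inv_inv]
  ring_nf

/-- The weak FE pair of the rotated theta function. -/
noncomputable def xiPair (z : ℂ) (hz : 0 < z.re) : WeakFEPair ℂ where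
  f := xiTh z
  g := xiTh z⁻¹
  k := 1 / 2
  ε := z ^ (-(1 / 2) : ℂ)
  f₀ := 1
  g₀ := 1
  hf_int := ContinuousOn.locallyIntegrableOn
    (fun _ hx => (xiaux_th_cont hz hx).continuousWithinAt) measurableSet_Ioi
  hg_int := ContinuousOn.locallyIntegrableOn
    (fun _ hx => (xiaux_th_cont (xiaux_inv_re hz) hx).continuousWithinAt) measurableSet_Ioi
  hk := by norm_num
  hε := by
    have hz0 : z ≠ 0 := by rintro rfl; simp at hz
    rw [Ne, cpow_eq_zero_iff]; tauto
  h_feq := fun x hx => by rw [smul_eq_mul]; exact xiaux_feq hz hx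
  hf_top := fun r => xiaux_th_top hz r
  hg_top := fun r => xiaux_th_top (xiaux_inv_re hz) r

lemma xiaux_strip (P : WeakFEPair ℂ) {s : ℂ} (h0 : 0 < s.re) (h1 : s.re < P.k) :
    HasMellin (fun x : ℝ => P.f x - P.f₀ - P.ε * (x : ℂ) ^ (-(P.k : ℂ)) * P.g₀) s (P.Λ s) := by
  have hA : HasMellin P.f_modif s (P.Λ₀ s) := by
    have := P.isStrongFEPair_toStrongFEPair.hasMellin s
    rw [P.isStrongFEPair_toStrongFEPair.Λ_eq] at this
    exact this
  have hB := hasMellin_one_Ioc h0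
  have hC : HasMellin (indicator (Ioi 1) (fun x : ℝ => (x : ℂ) ^ (-(P.k : ℂ)))) s
      (1 / (P.k - s)) := by
    have hre : (s - 1 - P.k : ℂ).re < -1 := by simp; linarith
    have e : ∀ t ∈ Ioi (0:ℝ), indicator (Ioi 1) (fun x : ℝ => (x : ℂ) ^ (s - 1 - P.k)) t =
        (t : ℂ) ^ (s - 1) • indicator (Ioi 1) (fun x : ℝ => (x : ℂ) ^ (-(P.k : ℂ))) t := by
      intro t (ht : 0 < t)
      by_cases h : t ∈ Ioi (1 : ℝ)
      · rw [indicator_of_mem h, indicator_of_mem h, smul_eq_mul,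
          ← cpow_add _ _ (ofReal_ne_zero.mpr ht.ne'), ← sub_eq_add_neg]
      · rw [indicator_of_notMem h, indicator_of_notMem h, smul_zero]
    have hi := integrableOn_Ioi_cpow_of_lt hre one_pos
    constructor
    · refine IntegrableOn.congr_fun ?_ e measurableSet_Ioi
      exact (hi.integrable_indicator measurableSet_Ioi).integrableOn
    · rw [mellin, ← setIntegral_congr_fun measurableSet_Ioi e,
        setIntegral_indicator measurableSet_Ioi]
      have : Ioi (0:ℝ) ∩ Ioi 1 = Ioi 1 := inter_eq_right.mpr (Ioi_subset_Ioi zero_le_one)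
      rw [this, integral_Ioi_cpow_of_lt hre one_pos]
      have hne : (P.k : ℂ) - s ≠ 0 := by
        intro h
        have := congrArg re h
        simp at this; linarith
      have hne' : s - 1 - P.k + 1 ≠ 0 := by
        intro h
        apply hne; linear_combination -h
      rw [ofReal_one, one_cpow, div_eq_div_iff hne' hne]
      ring
  have hB' := hB.1.const_smul P.f₀
  have hC' := hC.1.const_smul (P.ε * P.g₀)
  have hD := hasMellin_sub hA.1 hB'
  have hE := hasMellin_sub hD.1 hC'
  rw [hD.2, mellin_const_smul, mellin_const_smul, hA.2, hB.2, hC.2] at hE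
  have hae : ∀ᵐ t : ℝ ∂(volume.restrict (Ioi (0:ℝ))),
      (t : ℂ) ^ (s - 1) • (P.f_modif t - P.f₀ • indicator (Ioc 0 1) (fun _ => 1 : ℝ → ℂ) t -
        (P.ε * P.g₀) • indicator (Ioi 1) (fun x : ℝ => (x : ℂ) ^ (-(P.k : ℂ))) t) =
      (t : ℂ) ^ (s - 1) • (P.f t - P.f₀ - P.ε * (t : ℂ) ^ (-(P.k : ℂ)) * P.g₀) := by
    have h1 : ∀ᵐ t ∂(volume.restrict (Ioi (0:ℝ))), t ≠ 1 :=
      ae_restrict_of_ae (Measure.ae_ne volume 1)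
    filter_upwards [h1, ae_restrict_mem measurableSet_Ioi] with t ht1 (ht0 : 0 < t)
    congr 1
    rw [WeakFEPair.f_modif, Pi.add_apply]
    rcases lt_or_gt_of_ne ht1 with h | h
    · rw [indicator_of_notMem (by simpa using h.le), indicator_of_mem (mem_Ioo.mpr ⟨ht0, h⟩),
        indicator_of_mem (mem_Ioc.mpr ⟨ht0, h.le⟩), indicator_of_notMem (by simpa using h.le),
        ofReal_cpow ht0.le]
      simp only [smul_eq_mul, ofReal_neg]
      ring
    · rw [indicator_of_mem (by simpa using h), indicator_of_notMem (by simp [h.le]),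
        indicator_of_notMem (by simp [h]), indicator_of_mem (by simpa using h)]
      simp only [smul_eq_mul]
      ring
  have hval : P.Λ₀ s - P.f₀ • (1 / s) - (P.ε * P.g₀) • (1 / (P.k - s)) = P.Λ s := by
    rw [WeakFEPair.Λ]
    simp only [smul_eq_mul]
    ring
  rw [← hval, ← hE.2]
  constructor
  · exact Integrable.congr hE.1 hae
  · exact (integral_congr_ae hae).symm

lemma xiaux_zeta {σ : ℝ} (hσ : 1 / 2 < σ) :
    completedRiemannZeta (2 * (σ : ℂ)) =
      (((Real.pi ^ (-σ) : ℝ) : ℂ) * Gamma σ) *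
        ∑' n : ℕ, (((((n : ℝ) + 1) ^ 2) ^ (-σ) : ℝ) : ℂ) := by
  have h2 : 1 < (2 * (σ : ℂ)).re := by simp; linarith
  rw [completedZeta_eq_tsum_of_one_lt_re h2, ← zeta_eq_tsum_one_div_nat_cpow h2,
    zeta_eq_tsum_one_div_nat_add_one_cpow h2]
  congr 1
  · rw [ofReal_cpow Real.pi_pos.le]
    congr 2 <;> push_cast <;> ring
  · refine tsum_congr fun n => ?_
    have hn : (0 : ℝ) < (n : ℝ) + 1 := by positivity
    rw [← Real.rpow_natCast, ← Real.rpow_mul hn.le, ofReal_cpow hn.le, one_div, ← cpow_neg]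
    push_cast
    congr 1
    ring

lemma xiaux_claim1 {z : ℂ} (hz : 0 < z.re) {σ : ℝ} (hσ : 1 / 2 < σ) :
    (xiPair z hz).Λ σ = 2 * z ^ (-(σ : ℂ)) * completedRiemannZeta (2 * (σ : ℂ)) := by
  have hz0 : z ≠ 0 := by rintro rfl; simp at hz
  have hσ0 : 0 < σ := by linarith
  have hM := ((xiPair z hz).hasMellin (s := (σ : ℂ)) hσ).2
  set r : ℕ → ℝ := fun n => Real.pi * ((n : ℝ) + 1) ^ 2 with hr
  have hrp : ∀ n, 0 < r n := fun n => by positivity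
  set F : ℕ → ℝ → ℂ := fun n t => (t : ℂ) ^ ((σ : ℂ) - 1) * cexp (-(((r n : ℂ) * z) * t)) with hF
  have hre : ∀ n, ((r n : ℂ) * z).re = r n * z.re := fun n => re_ofReal_mul _ _
  have hnorm : ∀ n, ∀ t ∈ Ioi (0 : ℝ), t ^ (σ - 1) * Real.exp (-((r n * z.re) * t)) = ‖F n t‖ := by
    intro n t (ht : 0 < t)
    rw [hF]
    dsimp only
    rw [norm_mul, norm_cpow_eq_rpow_re_of_pos ht, norm_exp]
    congr 1
    simp
  have hmeas : ∀ n, AEStronglyMeasurable (F n) (volume.restrict (Ioi 0)) := by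
    intro n
    refine ContinuousOn.aestronglyMeasurable (fun t (ht : 0 < t) => ?_) measurableSet_Ioi
    refine ContinuousAt.continuousWithinAt ?_
    refine ContinuousAt.mul (continuousAt_ofReal_cpow_const _ _ (Or.inr ht.ne')) (by fun_prop)
  have hint : ∀ n, Integrable (F n) (volume.restrict (Ioi 0)) := by
    intro n
    rw [← integrable_norm_iff (hmeas n)]
    exact (xiaux_integrable hσ0 (mul_pos (hrp n) hz)).congr_fun (hnorm n) measurableSet_Ioi
  have hsum0 : Summable (fun n : ℕ => (((n : ℝ) + 1) ^ 2) ^ (-σ)) := by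
    have h := (summable_nat_add_iff 1).mpr (Real.summable_nat_rpow (p := -(2 * σ))|>.mpr (by linarith))
    refine h.congr fun n => ?_
    have hn : (0 : ℝ) < (n : ℝ) + 1 := by positivity
    rw [← Real.rpow_natCast, ← Real.rpow_mul hn.le]
    push_cast
    ring_nf
  have hsum : Summable (fun n => ∫ t in Ioi (0 : ℝ), ‖F n t‖) := by
    refine (hsum0.mul_left ((Real.pi * z.re) ^ (-σ) * Real.Gamma σ)).congr fun n => ?_
    rw [← setIntegral_congr_fun measurableSet_Ioi (hnorm n),
      Real.integral_rpow_mul_exp_neg_mul_Ioi hσ0 (mul_pos (hrp n) hz), one_div,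
      Real.inv_rpow (mul_pos (hrp n) hz).le, ← Real.rpow_neg (mul_pos (hrp n) hz).le]
    have : r n * z.re = (Real.pi * z.re) * ((n : ℝ) + 1) ^ 2 := by rw [hr]; ring
    rw [this, Real.mul_rpow (x := Real.pi * z.re) (y := ((n : ℝ) + 1) ^ 2) (by positivity) (by positivity)]
    ring
  have hS := (hasSum_integral_of_summable_integral_norm hint hsum).tsum_eq
  have hpt : ∀ t ∈ Ioi (0 : ℝ), ∑' n, F n t =
      (t : ℂ) ^ ((σ : ℂ) - 1) • ((xiTh z t - 1) / 2) := by
    intro t (ht : 0 < t)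
    have h := (hasSum_nat_jacobiTheta (τ := I * z * t) (by rw [xiaux_im]; positivity)).mul_left
      ((t : ℂ) ^ ((σ : ℂ) - 1))
    rw [smul_eq_mul, xiTh, ← h.tsum_eq]
    refine tsum_congr fun n => ?_
    rw [hF]
    dsimp only
    congr 2
    rw [hr]
    push_cast
    linear_combination (-Real.pi * ((n : ℂ) + 1) ^ 2 * z * t) * I_mul_I
  rw [setIntegral_congr_fun measurableSet_Ioi hpt] at hS
  change _ = mellin (fun t => (xiTh z t - 1) / 2) (σ : ℂ) at hS
  rw [mellin_div_const] at hS
  change mellin (fun t => xiTh z t - 1) (σ : ℂ) = _ at hM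
  rw [hM] at hS
  have hterm : ∀ n, ∫ t in Ioi (0 : ℝ), F n t =
      (z ^ (-(σ : ℂ)) * (((Real.pi ^ (-σ) : ℝ) : ℂ) * Gamma σ)) *
        (((((n : ℝ) + 1) ^ 2) ^ (-σ) : ℝ) : ℂ) := by
    intro n
    rw [hF]
    dsimp only
    rw [xiaux_gamma hσ0 (by rw [hre]; exact mul_pos (hrp n) hz), xiaux_mul_cpow (hrp n) hz0,
      ← ofReal_neg, ← ofReal_cpow (hrp n).le, hr]
    dsimp only
    rw [Real.mul_rpow (by positivity) (by positivity)]
    push_cast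
    ring
  rw [tsum_congr hterm, tsum_mul_left] at hS
  rw [xiaux_zeta hσ]
  linear_combination -2 * hS

lemma xiaux_claim2 {z : ℂ} (hz : 0 < z.re) {s : ℂ} (hs0 : s ≠ 0) (hs1 : s ≠ 1 / 2) :
    (xiPair z hz).Λ s = 2 * z ^ (-s) * completedRiemannZeta (2 * s) := by
  have hz0 : z ≠ 0 := by rintro rfl; simp at hz
  set P := xiPair z hz with hP
  let A : ℂ → ℂ := fun s => s * (1 / 2 - s) * P.Λ₀ s - (1 / 2 - s) - s * P.ε
  let B : ℂ → ℂ := fun s => 2 * z ^ (-s) *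
    (s * (1 / 2 - s) * completedRiemannZeta₀ (2 * s) - (1 / 2 - s) / 2 - s / 2)
  have hA : ∀ s : ℂ, s ≠ 0 → s ≠ 1 / 2 → A s = s * (1 / 2 - s) * P.Λ s := by
    intro s h0 h1
    have h1' : (1 / 2 - s : ℂ) ≠ 0 := sub_ne_zero.mpr h1.symm
    have hk : (P.k : ℂ) = 1 / 2 := by simp [hP, xiPair]
    have hf : P.f₀ = 1 := rfl
    have hg : P.g₀ = 1 := rfl
    simp only [A]
    rw [P.Λ₀_eq, hk, hf, hg, smul_eq_mul, smul_eq_mul]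
    have e1 : s * s⁻¹ = 1 := mul_inv_cancel₀ h0
    have e2 : (1 / 2 - s) * (1 / 2 - s)⁻¹ = 1 := mul_inv_cancel₀ h1'
    linear_combination (1 / 2 - s) * e1 + s * P.ε * e2
  have hB : ∀ s : ℂ, s ≠ 0 → s ≠ 1 / 2 →
      B s = s * (1 / 2 - s) * (2 * z ^ (-s) * completedRiemannZeta (2 * s)) := by
    intro s h0 h1
    have h1' : (1 - 2 * s : ℂ) ≠ 0 := by
      intro h; apply h1; linear_combination (-1 / 2) * h
    simp only [B]
    rw [completedRiemannZeta_eq]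
    field_simp
  have hAd : Differentiable ℂ A := by
    have := P.differentiable_Λ₀
    fun_prop
  have hBd : Differentiable ℂ B := by
    have := differentiable_completedZeta₀
    have h2 : Differentiable ℂ (fun s : ℂ => z ^ (-s)) := by
      intro s
      exact DifferentiableAt.const_cpow (by fun_prop) (Or.inl hz0)
    fun_prop
  have hseq : Tendsto (fun n : ℕ => ((1 + 1 / ((n : ℝ) + 1) : ℝ) : ℂ)) atTop (𝓝[≠] 1) := by
    refine tendsto_nhdsWithin_iff.mpr ⟨?_, Eventually.of_forall fun n => ?_⟩
    · have := (tendsto_one_div_add_atTop_nhds_zero_nat (𝕜 := ℝ)).const_add 1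
      rw [add_zero] at this
      have h2 := (continuous_ofReal.tendsto (1 : ℝ)).comp this
      rw [ofReal_one] at h2
      exact h2
    · have : (0 : ℝ) < 1 / ((n : ℝ) + 1) := by positivity
      simp only [mem_compl_iff, mem_singleton_iff]
      intro h
      rw [← ofReal_one, ofReal_inj] at h
      linarith
  have hfreq : ∃ᶠ z in 𝓝[≠] (1 : ℂ), A z = B z := by
    refine hseq.frequently (Frequently.of_forall fun n => ?_)
    have hp : 0 < (1 / ((n : ℝ) + 1) : ℝ) := by positivity
    set σ : ℝ := 1 + 1 / ((n : ℝ) + 1) with hσ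
    have h0 : (σ : ℂ) ≠ 0 := ofReal_ne_zero.mpr (by linarith)
    have h1 : (σ : ℂ) ≠ 1 / 2 := by
      intro h
      have := congrArg re h
      norm_num at this
      linarith
    rw [hA _ h0 h1, hB _ h0 h1, xiaux_claim1 hz (by linarith)]
  have hAB : A = B :=
    AnalyticOnNhd.eq_of_frequently_eq (fun s _ => hAd.analyticAt s) (fun s _ => hBd.analyticAt s) hfreq
  have h := congrFun hAB s
  rw [hA s hs0 hs1, hB s hs0 hs1] at h
  exact mul_left_cancel₀ (mul_ne_zero hs0 (sub_ne_zero.mpr hs1.symm)) h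

lemma xiaux_zre {α : ℝ} (hα : |α| < Real.pi / 4) : 0 < (cexp (2 * α * I)).re := by
  have h : (2 * α * I : ℂ) = ((2 * α : ℝ) : ℂ) * I := by push_cast; ring
  rw [h, exp_ofReal_mul_I_re]
  rw [abs_lt] at hα
  exact Real.cos_pos_of_mem_Ioo ⟨by linarith, by linarith⟩

lemma xiaux_zpow {α : ℝ} (hα : |α| < Real.pi / 4) (s : ℂ) :
    (cexp (2 * α * I)) ^ s = cexp (2 * α * I * s) := by
  rw [cpow_def_of_ne_zero (exp_ne_zero _), log_exp]
  · simp; rw [abs_lt] at hα; linarith [Real.pi_pos]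
  · simp; rw [abs_lt] at hα; linarith [Real.pi_pos]

/-- The function whose Mellin transform is the completed zeta function on the critical line. -/
noncomputable def xiH (α : ℝ) (x : ℝ) : ℂ :=
  xiTh (cexp (2 * α * I)) x - 1 - cexp (-(α * I)) * (x : ℂ) ^ (-(1 / 2 : ℂ))

/-- The completed zeta function on the critical line. -/
noncomputable def xiL (y : ℝ) : ℂ := completedRiemannZeta (1 / 2 + 2 * y * I)

lemma xiaux_H {α : ℝ} (hα : |α| < Real.pi / 4) (y : ℝ) :
    HasMellin (xiH α) (((1 / 4 : ℝ) : ℂ) + y * I)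
      (2 * cexp (-(α / 2 * I)) * (cexp (2 * α * y) * xiL y)) := by
  have hz := xiaux_zre hα
  have hre : (((1 / 4 : ℝ) : ℂ) + y * I).re = 1 / 4 := by simp
  have h := xiaux_strip (xiPair _ hz) (s := ((1 / 4 : ℝ) : ℂ) + y * I) (by rw [hre]; norm_num)
    (by rw [hre]; change (1 / 4 : ℝ) < 1 / 2; norm_num)
  rw [xiaux_claim2 hz (by intro h; have := congrArg re h; rw [hre] at this; norm_num at this)
    (by intro h; have := congrArg re h; rw [hre] at this; norm_num at this), xiaux_zpow hα] at h
  have e1 : 2 * cexp (2 * α * I * -(((1 / 4 : ℝ) : ℂ) + y * I)) *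
      completedRiemannZeta (2 * (((1 / 4 : ℝ) : ℂ) + y * I)) =
      2 * cexp (-(α / 2 * I)) * (cexp (2 * α * y) * xiL y) := by
    have a1 : 2 * α * I * -(((1 / 4 : ℝ) : ℂ) + y * I) = -(α / 2 * I) + 2 * α * y := by
      push_cast
      linear_combination (-2 * α * y : ℂ) * I_mul_I
    have a2 : 2 * (((1 / 4 : ℝ) : ℂ) + y * I) = 1 / 2 + 2 * y * I := by push_cast; ring
    rw [a1, a2, exp_add, xiL]
    ring
  rw [e1] at h
  convert h using 1
  ext x
  have hε : (xiPair _ hz).ε = cexp (-(α * I)) := by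
    change (cexp (2 * α * I)) ^ (-(1 / 2) : ℂ) = _
    rw [xiaux_zpow hα]
    congr 1
    ring
  have hk : ((xiPair _ hz).k : ℂ) = 1 / 2 := by
    change (((1 / 2 : ℝ)) : ℂ) = _
    push_cast; rfl
  rw [hε, hk]
  change _ = xiTh _ x - 1 - _ * _ * 1
  rw [mul_one, xiH]

lemma xiaux_L_cont : Continuous xiL := by
  rw [continuous_iff_continuousAt]
  intro y
  have h : ContinuousAt completedRiemannZeta (1 / 2 + 2 * y * I) := by
    refine (differentiableAt_completedZeta ?_ ?_).continuousAt
    · intro h; have := congrArg re h; norm_num at this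
    · intro h; have := congrArg re h; norm_num at this
  exact ContinuousAt.comp (f := fun y : ℝ => (1 / 2 + 2 * y * I : ℂ)) h (by fun_prop)

lemma xiaux_bound {α : ℝ} (hα : |α| < Real.pi / 4) :
    ∃ C : ℝ, ∀ y : ℝ, ‖xiL y‖ * Real.exp (2 * α * y) ≤ C := by
  refine ⟨∫ t in Ioi (0 : ℝ), t ^ (-(3 / 4) : ℝ) * ‖xiH α t‖, fun y => ?_⟩
  have h := (xiaux_H hα y).2
  have h2 : ‖2 * cexp (-(α / 2 * I)) * (cexp (2 * α * y) * xiL y)‖ =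
      2 * (‖xiL y‖ * Real.exp (2 * α * y)) := by
    have a1 : ‖cexp (-(α / 2 * I))‖ = 1 := by
      rw [norm_exp]; simp
    have a2 : ‖cexp (2 * α * y)‖ = Real.exp (2 * α * y) := by
      rw [norm_exp]; simp
    rw [norm_mul, norm_mul, norm_mul, a1, a2]
    simp
    ring
  have h3 : ‖mellin (xiH α) (((1 / 4 : ℝ) : ℂ) + y * I)‖ ≤
      ∫ t in Ioi (0 : ℝ), t ^ (-(3 / 4) : ℝ) * ‖xiH α t‖ := by
    refine (norm_integral_le_integral_norm _).trans (le_of_eq ?_)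
    refine setIntegral_congr_fun measurableSet_Ioi fun t (ht : 0 < t) => ?_
    rw [norm_smul, norm_cpow_eq_rpow_re_of_pos ht]
    congr 2
    simp; norm_num
  rw [h, h2] at h3
  have : 0 ≤ ‖xiL y‖ * Real.exp (2 * α * y) := by positivity
  linarith

lemma xiaux_int {α : ℝ} (hα : |α| < Real.pi / 4) :
    Integrable (fun y : ℝ => cexp (2 * α * y) * xiL y) := by
  obtain ⟨β, hβ1, hβ2⟩ := exists_between hα
  have hβ0 : 0 < β := (abs_nonneg α).trans_lt hβ1
  obtain ⟨C1, h1⟩ := xiaux_bound (α := β) (by rwa [abs_of_pos hβ0])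
  obtain ⟨C2, h2⟩ := xiaux_bound (α := -β) (by rwa [abs_neg, abs_of_pos hβ0])
  rw [abs_lt] at hβ1
  have hc : Continuous (fun y : ℝ => cexp (2 * α * y) * xiL y) := by
    have := xiaux_L_cont
    fun_prop
  have hn : ∀ y : ℝ, ‖cexp (2 * α * y) * xiL y‖ = ‖xiL y‖ * Real.exp (2 * α * y) := by
    intro y
    rw [norm_mul, norm_exp, mul_comm]; simp
  rw [← integrableOn_univ, ← Iic_union_Ioi (a := (0 : ℝ))]
  refine IntegrableOn.union ?_ ?_
  · refine Integrable.mono' ((integrableOn_exp_mul_Iic (a := 2 * (α + β)) (by linarith) 0).const_mul C2)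
      hc.aestronglyMeasurable (Eventually.of_forall fun y => ?_)
    rw [hn]
    calc _ = (‖xiL y‖ * Real.exp (2 * (-β) * y)) * Real.exp (2 * (α + β) * y) := by
          rw [mul_assoc ‖xiL y‖, ← Real.exp_add]; ring_nf
      _ ≤ _ := by gcongr; exact h2 y
  · refine Integrable.mono' ((integrableOn_exp_mul_Ioi (a := 2 * (α - β)) (by linarith) 0).const_mul C1)
      hc.aestronglyMeasurable (Eventually.of_forall fun y => ?_)
    rw [hn]
    calc _ = (‖xiL y‖ * Real.exp (2 * β * y)) * Real.exp (2 * (α - β) * y) := by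
          rw [mul_assoc ‖xiL y‖, ← Real.exp_add]; ring_nf
      _ ≤ _ := by gcongr; exact h1 y

lemma xiaux_inv {α : ℝ} (hα : |α| < Real.pi / 4) :
    ∫ y : ℝ, cexp (2 * α * y) * xiL y =
      Real.pi * (cexp (α / 2 * I) * xiTh (cexp (2 * α * I)) 1 - 2 * Real.cos (α / 2)) := by
  have hc : MellinConvergent (xiH α) ((1 / 4 : ℝ) : ℂ) := by
    have := (xiaux_H hα 0).1
    simpa using this
  have hv : (fun y : ℝ => mellin (xiH α) (((1 / 4 : ℝ) : ℂ) + y * I)) =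
      fun y : ℝ => 2 * cexp (-(α / 2 * I)) * (cexp (2 * α * y) * xiL y) :=
    funext fun y => (xiaux_H hα y).2
  have hV : VerticalIntegrable (mellin (xiH α)) (1 / 4) := by
    rw [VerticalIntegrable, hv]
    exact (xiaux_int hα).const_mul _
  have hx : ContinuousAt (xiH α) 1 := by
    unfold xiH
    refine ((xiaux_th_cont (xiaux_zre hα) one_pos).sub continuousAt_const).sub
      (continuousAt_const.mul (continuousAt_ofReal_cpow_const _ _ (Or.inr one_ne_zero)))
  have h := mellinInv_mellin_eq (1 / 4) (xiH α) one_pos hc hV hx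
  rw [mellinInv] at h
  have e : ∀ y : ℝ, ((1 : ℝ) : ℂ) ^ (-(((1 / 4 : ℝ) : ℂ) + y * I)) •
      mellin (xiH α) (((1 / 4 : ℝ) : ℂ) + y * I) =
      2 * cexp (-(α / 2 * I)) * (cexp (2 * α * y) * xiL y) := fun y => by
    rw [ofReal_one, one_cpow, one_smul, (xiaux_H hα y).2]
  simp_rw [e] at h
  rw [integral_const_mul, xiH, ofReal_one, one_cpow, mul_one, real_smul] at h
  have hE : cexp (α / 2 * I) * cexp (-(α / 2 * I)) = 1 := by
    rw [← exp_add]; simp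
  have hE2 : cexp (α / 2 * I) * cexp (-(α * I)) = cexp (-(α / 2 * I)) := by
    rw [← exp_add]; congr 1; ring
  have hcos : (2 * Real.cos (α / 2) : ℂ) = cexp (α / 2 * I) + cexp (-(α / 2 * I)) := by
    rw [ofReal_cos, two_cos]
    push_cast
    rw [neg_mul]
  rw [hcos]
  have hpi : (Real.pi : ℂ) ≠ 0 := ofReal_ne_zero.mpr Real.pi_ne_zero
  push_cast at h
  generalize (∫ y : ℝ, cexp (2 * α * y) * xiL y) = J at h ⊢
  have h' : cexp (-(α / 2 * I)) * J =
      Real.pi * (xiTh (cexp (2 * α * I)) 1 - 1 - cexp (-(α * I))) := by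
    rw [← h]; field_simp
  linear_combination cexp (α / 2 * I) * h' - J * hE - Real.pi * hE2

lemma xiaux_shift {τ : ℂ} (hτ : 0 < τ.im) :
    jacobiTheta (-1 + τ) = 2 * jacobiTheta (4 * τ) - jacobiTheta τ := by
  have hτ1 : 0 < (-1 + τ).im := by simpa using hτ
  have hτ4 : 0 < (4 * τ).im := by simpa using hτ
  have hA := hasSum_nat_jacobiTheta hτ
  have hB := hasSum_nat_jacobiTheta hτ1
  have hC := (hasSum_nat_jacobiTheta hτ4).mul_left 2
  have hAB := hA.add hB
  have h0 : HasSum (fun k : ℕ => (fun n : ℕ => cexp (Real.pi * I * ((n : ℂ) + 1) ^ 2 * τ) +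
      cexp (Real.pi * I * ((n : ℂ) + 1) ^ 2 * (-1 + τ))) (2 * k)) 0 := by
    convert hasSum_zero with k
    push_cast
    have : Real.pi * I * (2 * (k : ℂ) + 1) ^ 2 * (-1 + τ) =
        (Real.pi * I * (2 * (k : ℂ) + 1) ^ 2 * τ + -(Real.pi * I)) +
          ((-(2 * (k : ℤ) ^ 2 + 2 * k) : ℤ) : ℂ) * (2 * Real.pi * I) := by
      push_cast; ring
    rw [this, exp_periodic.int_mul, exp_add, exp_neg, exp_pi_mul_I]
    norm_num
  have h1 : HasSum (fun k : ℕ => (fun n : ℕ => cexp (Real.pi * I * ((n : ℂ) + 1) ^ 2 * τ) +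
      cexp (Real.pi * I * ((n : ℂ) + 1) ^ 2 * (-1 + τ))) (2 * k + 1))
      (2 * ((jacobiTheta (4 * τ) - 1) / 2)) := by
    have hfun : ∀ G : ℕ → ℂ, (∀ k : ℕ, G k = 2 * cexp (Real.pi * I * ((k : ℂ) + 1) ^ 2 * (4 * τ))) →
        HasSum G (2 * ((jacobiTheta (4 * τ) - 1) / 2)) := fun G hG => by
      rw [funext hG]; exact hC
    refine hfun _ fun k => ?_
    push_cast
    have : Real.pi * I * (2 * (k : ℂ) + 1 + 1) ^ 2 * (-1 + τ) =
        (Real.pi * I * ((k : ℂ) + 1) ^ 2 * (4 * τ)) +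
          ((-(2 * ((k : ℤ) + 1) ^ 2) : ℤ) : ℂ) * (2 * Real.pi * I) := by
      push_cast; ring
    rw [this, exp_periodic.int_mul]
    have : Real.pi * I * (2 * (k : ℂ) + 1 + 1) ^ 2 * τ =
        Real.pi * I * ((k : ℂ) + 1) ^ 2 * (4 * τ) := by ring
    rw [this]
    ring
  have h := hAB.unique (h0.even_add_odd h1)
  linear_combination 2 * h

lemma xiaux_small {w : ℂ} (hw : 5 ≤ w.re) : ‖xiTh w 1 - 1‖ ≤ 1 / 100000 := by
  have him : (I * w * (1 : ℝ)).im = w.re := by rw [xiaux_im, mul_one]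
  have h := norm_jacobiTheta_sub_one_le (τ := I * w * (1 : ℝ)) (by rw [him]; linarith)
  rw [him] at h
  have hq : Real.exp (-Real.pi * w.re) ≤ 1 / 1000000 := by
    have h1 : Real.exp (-Real.pi * w.re) ≤ Real.exp (-15) := by
      apply Real.exp_le_exp.mpr
      nlinarith [Real.pi_gt_three]
    have h2 : Real.exp (-15) = (Real.exp 1 ^ 15)⁻¹ := by
      rw [← Real.exp_nat_mul, ← Real.exp_neg]; norm_num
    have h3 : (2.7 : ℝ) ^ 15 ≤ Real.exp 1 ^ 15 := by
      gcongr; linarith [Real.exp_one_gt_d9]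
    have h4 : (Real.exp 1 ^ 15)⁻¹ ≤ ((2.7 : ℝ) ^ 15)⁻¹ := by gcongr
    rw [h2] at h1
    refine h1.trans (h4.trans ?_)
    norm_num
  have hq0 := Real.exp_pos (-Real.pi * w.re)
  set q := Real.exp (-Real.pi * w.re)
  refine h.trans ?_
  rw [div_mul_eq_mul_div, div_le_iff₀ (by linarith)]
  linarith

lemma xiaux_feq1 {w : ℂ} (hw : 0 < w.re) :
    xiTh w 1 = w ^ (-(1 / 2) : ℂ) * xiTh w⁻¹ 1 := by
  have := xiaux_feq hw one_pos
  simpa using this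

lemma xiaux_theta_small {δ : ℝ} (h1 : 1 / 100 ≤ δ) (h2 : δ ≤ 1 / 50) :
    ‖xiTh (cexp (2 * (Real.pi / 4 - δ : ℝ) * I)) 1‖ ≤ 1 / 1000 := by
  set w : ℂ := ⟨Real.sin (2 * δ), Real.cos (2 * δ) - 1⟩ with hw
  have hsin : 2 * δ - (2 * δ) ^ 3 / 6 < Real.sin (2 * δ) := Real.sin_gt_sub_cube (by linarith)
  have hsin2 : 1 / 100 ≤ Real.sin (2 * δ) := by
    nlinarith [pow_le_pow_left₀ (by linarith : (0:ℝ) ≤ δ) h2 3]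
  have hcos : 1 - (2 * δ) ^ 2 / 2 ≤ Real.cos (2 * δ) := Real.one_sub_sq_div_two_le_cos
  have hwre : w.re = Real.sin (2 * δ) := rfl
  have hwim : w.im = Real.cos (2 * δ) - 1 := rfl
  have hwpos : 0 < w.re := by rw [hwre]; linarith
  have hw0 : w ≠ 0 := by intro h; rw [h] at hwpos; simp at hwpos
  have hz : cexp (2 * (Real.pi / 4 - δ : ℝ) * I) = I + w := by
    have e : (2 * (Real.pi / 4 - δ : ℝ) * I : ℂ) = ((Real.pi / 2 - 2 * δ : ℝ) : ℂ) * I := by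
      push_cast; ring
    rw [e]
    apply Complex.ext
    · rw [exp_ofReal_mul_I_re, Real.cos_pi_div_two_sub, add_re, hwre, I_re, zero_add]
    · rw [exp_ofReal_mul_I_im, Real.sin_pi_div_two_sub, add_im, hwim, I_im]; ring
  have e1 : xiTh (I + w) 1 = 2 * xiTh (4 * w) 1 - xiTh w 1 := by
    have := xiaux_shift (τ := I * w * (1 : ℝ)) (by rw [xiaux_im]; simpa using hwpos)
    unfold xiTh
    have a1 : I * (I + w) * (1 : ℝ) = -1 + I * w * (1 : ℝ) := by
      push_cast; linear_combination I_mul_I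
    have a2 : I * (4 * w) * (1 : ℝ) = 4 * (I * w * (1 : ℝ)) := by ring
    rw [a1, a2, this]
  have h4w : 0 < (4 * w).re := by simpa using hwpos
  have e2 : (4 * w) ^ (-(1 / 2) : ℂ) = 1 / 2 * w ^ (-(1 / 2) : ℂ) := by
    have := xiaux_mul_cpow (r := 4) (by norm_num) hw0 (-(1 / 2))
    rw [ofReal_ofNat] at this
    rw [this]
    congr 1
    have h4 : (4 : ℝ) ^ (-(1 / 2) : ℝ) = 1 / 2 := by
      rw [show (4 : ℝ) = 2 ^ (2 : ℝ) by norm_num, ← Real.rpow_mul (by norm_num)]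
      norm_num [Real.rpow_neg_one]
    have := congrArg (fun x : ℝ => (x : ℂ)) h4
    rw [ofReal_cpow (by norm_num)] at this
    push_cast at this
    exact this
  have e3 : xiTh (I + w) 1 = w ^ (-(1 / 2) : ℂ) * ((xiTh (4 * w)⁻¹ 1 - 1) - (xiTh w⁻¹ 1 - 1)) := by
    rw [e1, xiaux_feq1 h4w, xiaux_feq1 hwpos, e2]
    ring
  have hsq : normSq w = 2 - 2 * Real.cos (2 * δ) := by
    rw [normSq_apply, hwre, hwim]
    nlinarith [Real.sin_sq_add_cos_sq (2 * δ)]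
  have hpos : 0 < normSq w := normSq_pos.mpr hw0
  have r1 : 20 ≤ (w⁻¹).re := by
    rw [inv_re, le_div_iff₀ hpos, hsq, hwre]
    nlinarith
  have r2 : ((4 * w)⁻¹).re = (w⁻¹).re / 4 := by
    rw [mul_inv, show ((4 : ℂ)⁻¹) = (((4 : ℝ)⁻¹ : ℝ) : ℂ) by push_cast; rfl, re_ofReal_mul]
    ring
  have b1 := xiaux_small (w := w⁻¹) (by linarith)
  have b2 := xiaux_small (w := (4 * w)⁻¹) (by rw [r2]; linarith)
  have hn : ‖w ^ (-(1 / 2) : ℂ)‖ ≤ 10 := by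
    have := norm_cpow_real w (-(1 / 2))
    push_cast at this
    rw [this]
    have hw1 : 1 / 100 ≤ ‖w‖ := by
      have := re_le_norm w
      rw [hwre] at this; linarith
    calc ‖w‖ ^ (-(1 / 2) : ℝ) ≤ (1 / 100 : ℝ) ^ (-(1 / 2) : ℝ) :=
          Real.rpow_le_rpow_of_nonpos (by norm_num) hw1 (by norm_num)
      _ = 10 := by
          rw [show (1 / 100 : ℝ) = 10 ^ (-2 : ℝ) by norm_num [Real.rpow_neg],
            ← Real.rpow_mul (by norm_num)]
          norm_num
  rw [hz, e3, norm_mul]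
  have hm := mul_le_mul hn ((norm_sub_le _ _).trans (add_le_add b2 b1)) (norm_nonneg _) (by norm_num)
  refine hm.trans ?_
  norm_num

lemma xiaux_re {α : ℝ} (hα : |α| < Real.pi / 4) :
    Integrable (fun y : ℝ => Real.exp (2 * α * y) * (xiL y).re) ∧
    ∫ y : ℝ, Real.exp (2 * α * y) * (xiL y).re =
      Real.pi * ((cexp (α / 2 * I) * xiTh (cexp (2 * α * I)) 1).re - 2 * Real.cos (α / 2)) := by
  have e : ∀ y : ℝ, (cexp (2 * α * y) * xiL y).re = Real.exp (2 * α * y) * (xiL y).re := by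
    intro y
    rw [show (2 * α * y : ℂ) = ((2 * α * y : ℝ) : ℂ) by push_cast; ring, ← ofReal_exp, re_ofReal_mul]
  have hi := xiaux_int hα
  have hi' := hi.re
  have h := integral_re hi
  simp only [RCLike.re_eq_complex_re, e] at hi' h
  refine ⟨hi', ?_⟩
  rw [h, xiaux_inv hα, re_ofReal_mul, sub_re]
  congr 2
  rw [show (2 * (Real.cos (α / 2) : ℝ) : ℂ) = ((2 * Real.cos (α / 2) : ℝ) : ℂ) by push_cast; rfl,
    ofReal_re]

lemma xiaux_even (y : ℝ) : xiL (-y) = xiL y := by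
  unfold xiL
  rw [← completedRiemannZeta_one_sub]
  congr 1
  push_cast
  ring

lemma xiaux_xi (y : ℝ) : (riemannXi ((1 / 2 : ℂ) + (2 * y : ℝ) * I)).re =
    (1 / 4 + (2 * y) ^ 2) / 2 * (xiL y).re := by
  unfold riemannXi xiL
  have e : ((1 / 2 : ℂ) + (2 * y : ℝ) * I) * (1 - ((1 / 2 : ℂ) + (2 * y : ℝ) * I)) / 2 =
      (((1 / 4 + (2 * y) ^ 2) / 2 : ℝ) : ℂ) := by
    push_cast
    linear_combination (-2 * (y : ℂ) ^ 2) * I_mul_I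
  rw [e, re_ofReal_mul]
  push_cast
  rfl

lemma xiaux_neg : ∃ y : ℝ, (xiL y).re < 0 := by
  by_contra! h
  have hα : |(0 : ℝ)| < Real.pi / 4 := by rw [abs_zero]; positivity
  have h1 := (xiaux_re hα).2
  have h2 : 0 ≤ ∫ y : ℝ, Real.exp (2 * 0 * y) * (xiL y).re :=
    integral_nonneg fun y => mul_nonneg (Real.exp_pos _).le (h y)
  rw [h1] at h2
  simp only [ofReal_zero, zero_div, zero_mul, mul_zero, exp_zero, one_mul, Real.cos_zero] at h2
  have him : (I * 1 * (1 : ℝ)).im = 1 := by simp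
  have h3 := norm_jacobiTheta_sub_one_le (τ := I * 1 * (1 : ℝ)) (by rw [him]; norm_num)
  rw [him, mul_one (-Real.pi)] at h3
  have hq : Real.exp (-Real.pi) ≤ 1 / 4 := by
    have a1 : Real.exp (-Real.pi) ≤ Real.exp (-2) := by
      apply Real.exp_le_exp.mpr
      linarith [Real.pi_gt_three]
    have a2 : Real.exp (-2) = (Real.exp 1 ^ 2)⁻¹ := by
      rw [← Real.exp_nat_mul, ← Real.exp_neg]; norm_num
    have a3 : (2 : ℝ) ^ 2 ≤ Real.exp 1 ^ 2 := by
      gcongr; linarith [Real.exp_one_gt_d9]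
    have a4 : (Real.exp 1 ^ 2)⁻¹ ≤ ((2 : ℝ) ^ 2)⁻¹ := by gcongr
    rw [a2] at a1
    refine a1.trans (a4.trans ?_)
    norm_num
  have hq0 := Real.exp_pos (-Real.pi)
  have h4 : ‖xiTh 1 1 - 1‖ ≤ 2 / 3 := by
    refine h3.trans ?_
    rw [div_mul_eq_mul_div, div_le_iff₀ (by linarith)]
    linarith
  have h5 := (re_le_norm (xiTh 1 1 - 1)).trans h4
  rw [sub_re, one_re] at h5
  nlinarith [Real.pi_pos]

lemma xiaux_pos : ∃ y : ℝ, 0 < (xiL y).re := by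
  by_contra! h
  have hpi := Real.pi_gt_three
  set a : ℝ := Real.pi / 4 - 1 / 50 with ha
  set b : ℝ := Real.pi / 4 - 1 / 100 with hb
  have ha' : |a| < Real.pi / 4 := by rw [abs_lt]; constructor <;> linarith
  have hb' : |b| < Real.pi / 4 := by rw [abs_lt]; constructor <;> linarith
  obtain ⟨ia, ea⟩ := xiaux_re ha'
  obtain ⟨ib, eb⟩ := xiaux_re hb'
  have hle : ∫ y : ℝ, Real.exp (2 * b * y) * (xiL y).re ≤
      ∫ y : ℝ, Real.exp (2 * a * y) * (xiL y).re := by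
    have sym : ∀ c : ℝ, ∫ y : ℝ, Real.exp (2 * c * -y) * (xiL y).re =
        ∫ y : ℝ, Real.exp (2 * c * y) * (xiL y).re := by
      intro c
      rw [← integral_neg_eq_self]
      refine integral_congr_ae (Eventually.of_forall fun y => ?_)
      dsimp only
      rw [neg_neg, xiaux_even]
    have symi : ∀ c : ℝ, Integrable (fun y : ℝ => Real.exp (2 * c * y) * (xiL y).re) →
        Integrable (fun y : ℝ => Real.exp (2 * c * -y) * (xiL y).re) := by
      intro c hc
      have := hc.comp_neg
      simpa only [xiaux_even] using this
    have key : ∫ y : ℝ, (Real.exp (2 * b * y) * (xiL y).re + Real.exp (2 * b * -y) * (xiL y).re) ≤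
        ∫ y : ℝ, (Real.exp (2 * a * y) * (xiL y).re + Real.exp (2 * a * -y) * (xiL y).re) := by
      refine integral_mono (ib.add (symi b ib)) (ia.add (symi a ia)) fun y => ?_
      dsimp only
      rw [← add_mul, ← add_mul]
      refine mul_le_mul_of_nonpos_right ?_ (h y)
      have hc : Real.cosh (2 * a * y) ≤ Real.cosh (2 * b * y) := by
        rw [Real.cosh_le_cosh, abs_mul (2 * a), abs_mul (2 * b), abs_of_pos (by linarith : 0 < 2 * a),
          abs_of_pos (by linarith : 0 < 2 * b)]
        gcongr
        linarith
      rw [Real.cosh_eq, Real.cosh_eq] at hc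
      rw [mul_neg, mul_neg]
      linarith
    rw [integral_add ib (symi b ib), integral_add ia (symi a ia), sym, sym] at key
    linarith
  rw [ea, eb] at hle
  have hle2 := le_of_mul_le_mul_left hle Real.pi_pos
  have n1 : ∀ c : ℝ, ∀ u : ℂ, ‖u‖ ≤ 1 / 1000 → |(cexp (c / 2 * I) * u).re| ≤ 1 / 1000 := by
    intro c u hu
    refine (abs_re_le_norm _).trans ?_
    rw [norm_mul, show (c / 2 * I : ℂ) = ((c / 2 : ℝ) : ℂ) * I by push_cast; ring,
      norm_exp_ofReal_mul_I, one_mul]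
    exact hu
  have na := n1 a _ (xiaux_theta_small (δ := 1 / 50) (by norm_num) (by norm_num))
  have nb := n1 b _ (xiaux_theta_small (δ := 1 / 100) (by norm_num) (by norm_num))
  rw [abs_le] at na nb
  have hcc := Real.cos_sub_cos (a / 2) (b / 2)
  have s1 : (a / 2 - b / 2) / 2 = -(1 / 400) := by rw [ha, hb]; ring
  rw [s1, Real.sin_neg] at hcc
  have s2 : (1 / 400 : ℝ) - (1 / 400) ^ 3 / 6 < Real.sin (1 / 400) := Real.sin_gt_sub_cube (by norm_num)
  have s3 : (0.3 : ℝ) - 0.3 ^ 3 / 6 < Real.sin 0.3 := Real.sin_gt_sub_cube (by norm_num)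
  have s4 : Real.sin 0.3 ≤ Real.sin ((a / 2 + b / 2) / 2) :=
    Real.sin_le_sin_of_le_of_le_pi_div_two (by linarith) (by linarith) (by linarith)
  have s5 : (0.29 : ℝ) * 0.0024 ≤ Real.sin ((a / 2 + b / 2) / 2) * Real.sin (1 / 400) := by
    apply mul_le_mul <;> linarith
  linarith [na.1, na.2, nb.1, nb.2]

end XiAux

theorem xi_sign_change_on_critical_line :
    ∃ t₁ t₂ : ℝ, 0 < (riemannXi ((1 / 2 : ℂ) + t₁ * Complex.I)).re ∧
      (riemannXi ((1 / 2 : ℂ) + t₂ * Complex.I)).re < 0 := by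
  obtain ⟨y₁, h₁⟩ := xiaux_pos
  obtain ⟨y₂, h₂⟩ := xiaux_neg
  refine ⟨2 * y₁, 2 * y₂, ?_, ?_⟩
  · rw [xiaux_xi]; positivity
  · rw [xiaux_xi]; exact mul_neg_of_pos_of_neg (by positivity) h₂
end

section
/- There exists a real number t such that ζ(1/2 + it) = 0; that is, the Riemann zeta function has a nontrivial zero on the critical line. -/
open Complex Real Set Filter Topology MeasureTheory Asymptotics


lemma integrableOn_cpow_exp (a r : ℂ) (ha : 0 < a.re) (hr : 0 < r.re) :
    IntegrableOn (fun x : ℝ => (x:ℂ) ^ (a - 1) * cexp (-(r * x))) (Ioi 0) := by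
  have h1 : MellinConvergent (fun x : ℝ => cexp (-(r * x))) a := by
    refine mellinConvergent_of_isBigO_rpow_exp (a := r.re) (b := 0) hr ?_ ?_ ?_ ha
    · exact ContinuousOn.locallyIntegrableOn (by fun_prop) measurableSet_Ioi
    · refine IsBigO.of_bound 1 (Eventually.of_forall fun x => ?_)
      simp [Complex.norm_exp]
    · refine IsBigO.of_bound 1 ?_
      filter_upwards [self_mem_nhdsWithin] with x hx
      have : 0 ≤ r.re * x := mul_nonneg hr.le (le_of_lt hx)
      simp [Complex.norm_exp, this]
  exact h1

lemma gamma_cint (a r : ℂ) (ha : 0 < a.re) (hr : 0 < r.re) :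
    ∫ x : ℝ in Ioi 0, (x:ℂ) ^ (a - 1) * cexp (-(r * x)) = r ^ (-a) * Complex.Gamma a := by
  have hopen : IsOpen {r : ℂ | 0 < r.re} := isOpen_lt continuous_const Complex.continuous_re
  have hconv : Convex ℝ {r : ℂ | 0 < r.re} := convex_halfSpace_re_gt 0
  have hd1 : DifferentiableOn ℂ (fun r : ℂ => ∫ x : ℝ in Ioi 0, (x:ℂ) ^ (a - 1) * cexp (-(r * x)))
      {r : ℂ | 0 < r.re} := by
    intro r₀ (hr₀ : 0 < r₀.re)
    have key := hasDerivAt_integral_of_dominated_loc_of_deriv_le (𝕜 := ℂ)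
      (μ := volume.restrict (Ioi (0:ℝ)))
      (F := fun (r : ℂ) (x : ℝ) => (x:ℂ) ^ (a - 1) * cexp (-(r * x)))
      (F' := fun (r : ℂ) (x : ℝ) => (x:ℂ) ^ (a - 1) * (cexp (-(r * x)) * (-x)))
      (x₀ := r₀) (s := Metric.ball r₀ (r₀.re / 2))
      (bound := fun x : ℝ => ‖(x:ℂ) ^ ((a + 1) - 1) * cexp (-(((r₀.re / 2 : ℝ) : ℂ) * x))‖)
      (Metric.ball_mem_nhds _ (by positivity)) ?_ ?_ ?_ ?_ ?_ ?_
    · exact key.2.differentiableAt.differentiableWithinAt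
    · filter_upwards [hopen.mem_nhds hr₀] with r hr
      exact (integrableOn_cpow_exp a r ha hr).aestronglyMeasurable
    · exact integrableOn_cpow_exp a r₀ ha hr₀
    · have := (integrableOn_cpow_exp (a + 1) r₀ (by simp; linarith) hr₀).aestronglyMeasurable.neg
      refine this.congr ?_
      filter_upwards [ae_restrict_mem measurableSet_Ioi] with x hx
      have hx0 : (x : ℂ) ≠ 0 := by exact_mod_cast (ne_of_gt hx)
      have : (x:ℂ) ^ (a + 1 - 1) = (x:ℂ)^(a-1) * x := by
        rw [show a + 1 - 1 = (a - 1) + 1 by ring, cpow_add _ _ hx0, cpow_one]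
      simp only [Pi.neg_apply, this]; ring
    · filter_upwards [ae_restrict_mem measurableSet_Ioi] with x hx r hr
      have hx0 : (x : ℂ) ≠ 0 := by exact_mod_cast (ne_of_gt hx)
      have : (x:ℂ) ^ (a + 1 - 1) = (x:ℂ)^(a-1) * x := by
        rw [show a + 1 - 1 = (a - 1) + 1 by ring, cpow_add _ _ hx0, cpow_one]
      rw [this, norm_mul, norm_mul, norm_mul, norm_mul, norm_neg, mul_assoc, mul_comm ‖(x:ℂ)‖]
      gcongr
      rw [Complex.norm_exp, Complex.norm_exp]
      apply Real.exp_le_exp.2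
      have h1 : |(r - r₀).re| < r₀.re / 2 := (abs_re_le_norm _).trans_lt (by simpa [Complex.dist_eq] using hr)
      have h2 := (abs_lt.1 h1).1
      simp only [sub_re] at h2
      have hx' : (0:ℝ) < x := hx
      simp
      nlinarith
    · exact (integrableOn_cpow_exp (a + 1) ((r₀.re / 2 : ℝ) : ℂ) (by simp; linarith)
        (by simp; linarith)).norm
    · filter_upwards with x r hr
      have : HasDerivAt (fun r : ℂ => -(r * (x:ℂ))) (-(x:ℂ)) r := by
        simpa using ((hasDerivAt_id' r).mul_const (x:ℂ)).fun_neg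
      exact (this.cexp).const_mul _
  have hd2 : DifferentiableOn ℂ (fun r : ℂ => r ^ (-a) * Complex.Gamma a) {r : ℂ | 0 < r.re} := by
    intro r hr
    have : r ∈ slitPlane := Or.inl hr
    exact ((differentiableAt_id.cpow_const this).mul_const _).differentiableWithinAt
  have := (hd1.analyticOnNhd hopen).eqOn_of_preconnected_of_frequently_eq (hd2.analyticOnNhd hopen)
    hconv.isPreconnected (z₀ := 1) (by simp) ?_
  · exact this hr
  · have ht : Tendsto (fun x : ℝ => (x : ℂ)) (𝓝[>] 1) (𝓝[≠] 1) := by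
      refine tendsto_nhdsWithin_iff.2 ⟨?_, ?_⟩
      · exact (continuous_ofReal.tendsto' 1 1 (by simp)).mono_left nhdsWithin_le_nhds
      · filter_upwards [self_mem_nhdsWithin] with x hx
        simp only [mem_compl_iff, mem_singleton_iff]
        exact_mod_cast (ne_of_gt hx)
    refine ht.frequently (Eventually.frequently ?_)
    filter_upwards [self_mem_nhdsWithin] with x hx
    have hx0 : (0:ℝ) < x := lt_trans one_pos hx
    rw [integral_cpow_mul_exp_neg_mul_Ioi ha hx0, one_div, inv_cpow, cpow_neg]
    rw [arg_ofReal_of_nonneg hx0.le]; exact Real.pi_pos.ne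


lemma real_mul_cpow {x : ℝ} (hx : 0 < x) {z : ℂ} (hz : z ≠ 0) (s : ℂ) :
    ((x : ℂ) * z) ^ s = (x : ℂ) ^ s * z ^ s := by
  have hx0 : (x : ℂ) ≠ 0 := by exact_mod_cast hx.ne'
  rw [cpow_def_of_ne_zero (mul_ne_zero hx0 hz), cpow_def_of_ne_zero hx0, cpow_def_of_ne_zero hz,
    log_ofReal_mul hx hz, ← Complex.exp_add, ofReal_log hx.le]
  ring_nf

lemma inv_re_pos {w : ℂ} (hw : 0 < w.re) : 0 < (1 / w).re := by
  have : w ≠ 0 := by rintro rfl; simp at hw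
  rw [one_div, inv_re]; exact div_pos hw (normSq_pos.2 this)

lemma im_rot {w : ℂ} (x : ℝ) : (I * w * x).im = w.re * x := by
  simp

lemma theta_cont {w : ℂ} (hw : 0 < w.re) {x : ℝ} (hx : 0 < x) :
    ContinuousAt (fun x : ℝ => jacobiTheta (I * w * x)) x := by
  have h : 0 < (I * w * x).im := by rw [im_rot]; positivity
  exact ContinuousAt.comp (f := fun x : ℝ => I * w * x) (continuousAt_jacobiTheta h) (by fun_prop)

lemma theta_top {w : ℂ} (hw : 0 < w.re) (r : ℝ) :
    (fun x : ℝ => jacobiTheta (I * w * x) - 1) =O[atTop] (fun x : ℝ => x ^ r) := by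
  have ht : Tendsto (fun x : ℝ => I * w * x) atTop (comap im atTop) := by
    rw [tendsto_comap_iff]
    have : (im ∘ fun x : ℝ => I * w * x) = fun x : ℝ => w.re * x := by
      ext x; exact im_rot x
    rw [this]
    exact tendsto_id.const_mul_atTop hw
  have h1 := isBigO_at_im_infty_jacobiTheta_sub_one.comp_tendsto ht
  refine h1.trans ?_
  have h2 := (isLittleO_exp_neg_mul_rpow_atTop (a := π * w.re) (by positivity) r).isBigO
  refine h2.congr' ?_ .rfl
  filter_upwards with x
  simp only [Function.comp, im_rot]; ring_nf

lemma theta_feq (τ : ℂ) (hτ : 0 < τ.im) :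
    jacobiTheta (-1 / τ) = (-I * τ) ^ (1 / 2 : ℂ) * jacobiTheta τ := by
  have h0 : τ ≠ 0 := by rintro rfl; simp at hτ
  have h1 : (-I * τ) ^ (1 / 2 : ℂ) ≠ 0 := by
    simp [cpow_eq_zero_iff, h0]
  have := jacobiTheta₂_functional_equation 0 τ
  rw [jacobiTheta_eq_jacobiTheta₂, jacobiTheta_eq_jacobiTheta₂, this]
  simp only [zero_div, ne_eq, OfNat.ofNat_ne_zero, not_false_eq_true, zero_pow, mul_zero, Complex.exp_zero]
  field_simp

noncomputable def rotPair (w : ℂ) (hw : 0 < w.re) : WeakFEPair ℂ where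
  f := fun x => jacobiTheta (I * w * x)
  g := fun x => jacobiTheta (I * (1 / w) * x)
  k := 1 / 2
  ε := (1 / w) ^ (1 / 2 : ℂ)
  f₀ := 1
  g₀ := 1
  hf_int := (continuousOn_of_forall_continuousAt
    fun x hx => theta_cont hw hx).locallyIntegrableOn measurableSet_Ioi
  hg_int := (continuousOn_of_forall_continuousAt
    fun x hx => theta_cont (inv_re_pos hw) hx).locallyIntegrableOn measurableSet_Ioi
  hk := by norm_num
  hε := by
    have : w ≠ 0 := by rintro rfl; simp at hw
    simp [cpow_eq_zero_iff, this]
  h_feq := by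
    intro x hx
    have hw0 : w ≠ 0 := by rintro rfl; simp at hw
    have hx' : (0:ℝ) < x := hx
    have hx0 : (x : ℂ) ≠ 0 := by exact_mod_cast hx'.ne'
    have h := theta_feq (I * (1 / w) * x) (by rw [im_rot]; exact mul_pos (inv_re_pos hw) hx')
    have e1 : -1 / (I * (1 / w) * x) = I * w * ((1 / x : ℝ) : ℂ) := by
      push_cast; field_simp; simp
    have e2 : -I * (I * (1 / w) * x) = (x : ℂ) * (1 / w) := by
      linear_combination (-(x:ℂ) * (1 / w)) * I_mul_I
    rw [e1, e2, real_mul_cpow hx' (by simp [hw0])] at h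
    rw [h, smul_eq_mul, ofReal_cpow hx'.le]
    push_cast; ring
  hf_top := theta_top hw
  hg_top := theta_top (inv_re_pos hw)


lemma rot_term {w : ℂ} (hw : 0 < w.re) (n : ℕ) (s : ℂ) :
    ((π : ℂ) * ((n : ℂ) + 1) ^ 2 * w) ^ (-s) =
      w ^ (-s) * ((π : ℂ) ^ (-s) * (1 / ((n : ℂ) + 1) ^ (2 * s))) := by
  have hw0 : w ≠ 0 := by rintro rfl; simp at hw
  have hn : (0:ℝ) < (n:ℝ) + 1 := by positivity
  have hn0 : ((n:ℂ) + 1) ≠ 0 := by exact_mod_cast hn.ne'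
  have e : (π : ℂ) * ((n : ℂ) + 1) ^ 2 * w
      = ((π : ℝ) : ℂ) * ((((n:ℝ) + 1 : ℝ) : ℂ) * ((((n:ℝ) + 1 : ℝ) : ℂ) * w)) := by
    push_cast; ring
  rw [e, real_mul_cpow Real.pi_pos, real_mul_cpow hn, real_mul_cpow hn hw0]
  · rw [one_div, ← cpow_neg, show -(2 * s) = -s + -s by ring]
    push_cast
    rw [cpow_add _ _ hn0]; ring
  · push_cast; exact mul_ne_zero hn0 hw0
  · push_cast; exact mul_ne_zero hn0 (mul_ne_zero hn0 hw0)

lemma mellin_rot {w : ℂ} (hw : 0 < w.re) {s : ℂ} (hs : 1 / 2 < s.re) :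
    mellin (fun x : ℝ => jacobiTheta (I * w * x) - 1) s =
      2 * (w ^ (-s) * completedRiemannZeta (2 * s)) := by
  have hs0 : 0 < s.re := by linarith
  set r : ℕ → ℂ := fun n => (π : ℂ) * ((n : ℂ) + 1) ^ 2 * w with hr
  have hrre : ∀ n, (r n).re = π * ((n:ℝ) + 1) ^ 2 * w.re := by
    intro n
    have : r n = ((π * ((n:ℝ) + 1) ^ 2 : ℝ) : ℂ) * w := by simp [hr]
    rw [this, re_ofReal_mul]
  have hrpos : ∀ n, 0 < (r n).re := fun n => by rw [hrre]; positivity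
  have h := hasSum_integral_of_summable_integral_norm (μ := volume.restrict (Ioi (0:ℝ)))
    (F := fun (n : ℕ) (x : ℝ) => (x:ℂ) ^ (s - 1) * cexp (-(r n * x)))
    (fun n => integrableOn_cpow_exp s (r n) hs0 (hrpos n)) ?_
  · have e1 : ∀ n, ∫ x : ℝ in Ioi 0, (x:ℂ) ^ (s - 1) * cexp (-(r n * x)) =
        w ^ (-s) * ((π : ℂ) ^ (-s) * (1 / ((n : ℂ) + 1) ^ (2 * s))) * Complex.Gamma s := by
      intro n
      rw [gamma_cint s (r n) hs0 (hrpos n), hr, rot_term hw]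
    simp_rw [e1] at h
    have e2 : ∫ x : ℝ in Ioi 0, ∑' n, (x:ℂ) ^ (s - 1) * cexp (-(r n * x)) =
        mellin (fun x : ℝ => jacobiTheta (I * w * x) - 1) s / 2 := by
      rw [mellin, ← integral_div]
      refine setIntegral_congr_fun measurableSet_Ioi fun x hx => ?_
      have hx' : (0:ℝ) < x := hx
      have := hasSum_nat_jacobiTheta (τ := I * w * x) (by rw [im_rot]; positivity)
      simp only [tsum_mul_left, smul_eq_mul, mul_div_assoc]
      rw [← this.tsum_eq]
      congr 2
      ext n
      congr 1
      simp only [hr]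
      linear_combination (-(π:ℂ) * ((n:ℂ)+1)^2 * w * x) * I_mul_I
    rw [e2] at h
    have h3 := h.tsum_eq
    simp_rw [tsum_mul_right, tsum_mul_left] at h3
    rw [completedZeta_eq_tsum_of_one_lt_re (by simp; linarith),
      ← zeta_eq_tsum_one_div_nat_cpow (by simp; linarith),
      zeta_eq_tsum_one_div_nat_add_one_cpow (by simp; linarith)]
    rw [show -(2 * s) / 2 = -s by ring, show 2 * s / 2 = s by ring]
    linear_combination (-2) * h3
  · have e : ∀ n, ∫ x : ℝ in Ioi 0, ‖(x:ℂ) ^ (s - 1) * cexp (-(r n * x))‖ =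
        ((1 / (π * w.re)) ^ s.re * Real.Gamma s.re) * (1 / ((n + 1 : ℕ) : ℝ) ^ (2 * s.re)) := by
      intro n
      have := Real.integral_rpow_mul_exp_neg_mul_Ioi hs0 (hrpos n)
      have e3 : (1 / (r n).re) ^ s.re = (1 / (π * w.re)) ^ s.re * (1 / ((n + 1 : ℕ) : ℝ) ^ (2 * s.re)) := by
        rw [hrre, Real.rpow_mul (by positivity), ← Real.one_rpow s.re, ← Real.div_rpow (by positivity) (by positivity),
          Real.one_rpow, ← Real.mul_rpow (by positivity) (by positivity)]
        congr 1
        push_cast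
        norm_num
        field_simp
      rw [mul_right_comm, ← e3, ← this]
      refine setIntegral_congr_fun measurableSet_Ioi fun x hx => ?_
      simp only [norm_mul]
      rw [norm_cpow_eq_rpow_re_of_pos hx, Complex.norm_exp]
      simp
    simp_rw [e]
    refine Summable.mul_left _ ?_
    exact (summable_nat_add_iff 1 (f := fun n : ℕ => 1 / (n : ℝ) ^ (2 * s.re))).2 (Real.summable_one_div_nat_rpow.2 (by linarith))

lemma rotPair_Λ {w : ℂ} (hw : 0 < w.re) {s : ℂ} (hs : s ≠ 0) (hs' : s ≠ 1 / 2) :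
    (rotPair w hw).Λ s = 2 * (w ^ (-s) * completedRiemannZeta (2 * s)) := by
  have hw0 : w ≠ 0 := by rintro rfl; simp at hw
  set P := rotPair w hw with hP
  set U : Set ℂ := ({0, 1 / 2} : Set ℂ)ᶜ with hU
  have hUo : IsOpen U := (Set.Finite.isClosed (by simp)).isOpen_compl
  have hUc : IsPreconnected U :=
    (Set.Countable.isConnected_compl_of_one_lt_rank (by simp) (by simp)).isPreconnected
  have hd1 : DifferentiableOn ℂ P.Λ U := by
    intro z hz
    simp only [hU, mem_compl_iff, mem_insert_iff, mem_singleton_iff, not_or] at hz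
    refine (P.differentiableAt_Λ (Or.inl hz.1) (Or.inl ?_)).differentiableWithinAt
    simpa [hP, rotPair] using hz.2
  have hd2 : DifferentiableOn ℂ (fun s : ℂ => 2 * (w ^ (-s) * completedRiemannZeta (2 * s))) U := by
    intro z hz
    simp only [hU, mem_compl_iff, mem_insert_iff, mem_singleton_iff, not_or] at hz
    have h1 : DifferentiableAt ℂ (fun s : ℂ => w ^ (-s)) z :=
      (differentiableAt_id.neg).const_cpow (Or.inl hw0)
    have h2 : DifferentiableAt ℂ (fun s : ℂ => completedRiemannZeta (2 * s)) z := by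
      refine DifferentiableAt.comp (f := fun s : ℂ => 2 * s) z (differentiableAt_completedZeta ?_ ?_) (by fun_prop)
      · simpa using hz.1
      · intro h; apply hz.2; linear_combination h / 2
    exact ((h1.mul h2).const_mul 2).differentiableWithinAt
  refine (hd1.analyticOnNhd hUo).eqOn_of_preconnected_of_eventuallyEq (hd2.analyticOnNhd hUo) hUc
    (z₀ := 1) (by simp [hU]) ?_ (by simp [hU, hs]; simpa using hs')
  have ho : IsOpen {z : ℂ | 1 / 2 < z.re} := isOpen_lt continuous_const Complex.continuous_re
  filter_upwards [ho.mem_nhds (by norm_num : (1:ℂ) ∈ {z : ℂ | 1 / 2 < z.re})] with z hz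
  have := P.hasMellin (s := z) hz
  rw [← mellin_rot hw hz, ← this.2]
  rfl


noncomputable def Hfun (w : ℂ) (x : ℝ) : ℂ :=
  jacobiTheta (I * w * x) - 1 - (1 / w) ^ (1 / 2 : ℂ) * (x : ℂ) ^ (-(1 / 2) : ℂ)

lemma hasMellin_cpow_Ioi1 (a s : ℂ) (h : s.re + a.re < 0) :
    HasMellin (indicator (Ioi 1) (fun t : ℝ => (t : ℂ) ^ a)) s (-1 / (s + a)) := by
  have hlt : (s - 1 + a).re < -1 := by simp; linarith
  have e : ∀ t : ℝ, (t : ℂ) ^ (s - 1) • indicator (Ioi 1) (fun t : ℝ => (t : ℂ) ^ a) t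
      = indicator (Ioi 1) (fun t : ℝ => (t : ℂ) ^ (s - 1 + a)) t := by
    intro t
    by_cases ht : t ∈ Ioi (1:ℝ)
    · have : (t : ℂ) ≠ 0 := by exact_mod_cast (lt_trans one_pos ht).ne'
      simp only [indicator_of_mem ht, smul_eq_mul, cpow_add _ _ this]
    · simp [indicator_of_notMem ht]
  have hsub : Ioi (0:ℝ) ∩ Ioi 1 = Ioi 1 := by
    apply inter_eq_right.2; exact Ioi_subset_Ioi zero_le_one
  constructor
  · rw [MellinConvergent]
    simp_rw [e]
    have := (integrableOn_Ioi_cpow_of_lt hlt one_pos)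
    exact ((integrable_indicator_iff measurableSet_Ioi).2 this).integrableOn
  · rw [mellin]
    simp_rw [e]
    rw [setIntegral_indicator measurableSet_Ioi, hsub, integral_Ioi_cpow_of_lt hlt one_pos]
    simp
    ring_nf

lemma hasMellin_H {w : ℂ} (hw : 0 < w.re) {s : ℂ} (hs : 0 < s.re) (hs' : s.re < 1 / 2) :
    HasMellin (Hfun w) s (2 * (w ^ (-s) * completedRiemannZeta (2 * s))) := by
  have hs0 : s ≠ 0 := by rintro rfl; simp at hs
  have hs1 : s ≠ 1 / 2 := by rintro rfl; norm_num at hs'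
  rw [← rotPair_Λ hw hs0 hs1]
  set P := rotPair w hw with hP
  have m1 : HasMellin P.f_modif s (P.Λ₀ s) := by
    have := P.isStrongFEPair_toStrongFEPair.hasMellin s
    rw [P.isStrongFEPair_toStrongFEPair.Λ_eq] at this
    exact this
  have m2 := hasMellin_one_Ioc hs
  have m3 := hasMellin_cpow_Ioi1 (-(1 / 2)) s (by norm_num; linarith)
  have m3' := hasMellin_const_smul m3.1 ((1 / w) ^ (1 / 2 : ℂ))
  have m4 := hasMellin_sub (hasMellin_sub m1.1 m2.1).1 m3'.1
  rw [(hasMellin_sub m1.1 m2.1).2, m3'.2, m1.2, m2.2, m3.2] at m4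
  have hval : P.Λ₀ s - 1 / s - (1 / w) ^ (1 / 2 : ℂ) • (-1 / (s + -(1 / 2))) = P.Λ s := by
    have h2 : s + -(1 / 2) ≠ 0 := by intro h; apply hs1; linear_combination h
    have h3 : (1 / 2 : ℂ) - s ≠ 0 := by intro h; apply hs1; linear_combination -h
    simp only [WeakFEPair.Λ, hP, rotPair, smul_eq_mul, mul_one]
    push_cast
    have : (-1 / (s + -(1 / 2)) : ℂ) = 1 / (1 / 2 - s) := by
      rw [div_eq_div_iff h2 h3]; ring
    rw [this]; ring
  rw [hval] at m4
  have hae : ∀ᵐ t : ℝ ∂(volume.restrict (Ioi (0:ℝ))), (t : ℂ) ^ (s - 1) •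
      (P.f_modif t - indicator (Ioc 0 1) (fun _ => 1 : ℝ → ℂ) t -
        (1 / w) ^ (1 / 2 : ℂ) • indicator (Ioi 1) (fun t : ℝ => (t : ℂ) ^ (-(1 / 2) : ℂ)) t)
      = (t : ℂ) ^ (s - 1) • Hfun w t := by
    have hne : ∀ᵐ t ∂(volume.restrict (Ioi (0:ℝ))), t ≠ 1 :=
      ae_restrict_of_ae (by simp [ae_iff])
    filter_upwards [ae_restrict_mem measurableSet_Ioi, hne] with t ht ht1
    congr 1
    have ht0 : (0:ℝ) < t := ht
    rcases lt_or_gt_of_ne ht1 with h | h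
    · have a1 : t ∈ Ioo (0:ℝ) 1 := ⟨ht0, h⟩
      have a2 : t ∈ Ioc (0:ℝ) 1 := ⟨ht0, h.le⟩
      have a3 : t ∉ Ioi (1:ℝ) := not_lt.2 h.le
      simp only [WeakFEPair.f_modif, Pi.add_apply, indicator_of_mem a1, indicator_of_mem a2,
        indicator_of_notMem a3, hP, rotPair, Hfun, smul_eq_mul, ofReal_cpow ht0.le]
      push_cast
      ring
    · have a1 : t ∉ Ioo (0:ℝ) 1 := fun h' => lt_asymm h h'.2
      have a2 : t ∉ Ioc (0:ℝ) 1 := fun h' => not_lt.2 h'.2 h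
      have a3 : t ∈ Ioi (1:ℝ) := h
      simp only [WeakFEPair.f_modif, Pi.add_apply, indicator_of_notMem a1, indicator_of_notMem a2,
        indicator_of_mem a3, hP, rotPair, Hfun, smul_eq_mul]
      ring
  exact ⟨m4.1.congr hae, (integral_congr_ae hae).symm.trans m4.2⟩

lemma norm_w_cpow {φ : ℝ} (h1 : -π < φ) (h2 : φ ≤ π) (t : ℝ) :
    (cexp (φ * I)) ^ (-(1 / 4 + t * I) : ℂ) = cexp (-(φ / 4) * I) * (Real.exp (φ * t) : ℝ) := by
  rw [cpow_def_of_ne_zero (Complex.exp_ne_zero _), Complex.log_exp (by simpa) (by simpa)]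
  push_cast
  rw [← Complex.exp_add]
  congr 1
  linear_combination (-(φ:ℂ) * t) * I_mul_I

/-- the completed zeta on the critical line, scaled -/
noncomputable def Zc (t : ℝ) : ℂ := completedRiemannZeta (1 / 2 + 2 * t * I)

lemma Zc_neg (t : ℝ) : Zc (-t) = Zc t := by
  rw [Zc, Zc, ← completedRiemannZeta_one_sub]; congr 1; push_cast; ring

lemma Zc_cont : Continuous Zc := by
  refine continuous_iff_continuousAt.2 fun t => ?_
  refine ContinuousAt.comp (f := fun t : ℝ => (1 / 2 + 2 * t * I : ℂ))
    (differentiableAt_completedZeta ?_ ?_).continuousAt (by fun_prop)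
  · intro h; simpa using congrArg re h
  · intro h; have := congrArg re h; norm_num at this

lemma cos_re {φ : ℝ} (h1 : -(π / 2) < φ) (h2 : φ < π / 2) : 0 < (cexp (φ * I)).re := by
  rw [exp_ofReal_mul_I_re]; exact Real.cos_pos_of_mem_Ioo ⟨h1, h2⟩

lemma mellin_H_line {φ : ℝ} (h1 : -(π / 2) < φ) (h2 : φ < π / 2) (t : ℝ) :
    HasMellin (Hfun (cexp (φ * I))) (1 / 4 + t * I)
      (2 * (cexp (-(φ / 4) * I) * (Real.exp (φ * t) : ℝ) * Zc t)) := by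
  have := hasMellin_H (cos_re h1 h2) (s := 1 / 4 + t * I) (by norm_num) (by norm_num)
  rw [norm_w_cpow (by linarith [Real.pi_pos]) (by linarith [Real.pi_pos])] at this
  have e : (2 * (1 / 4 + t * I) : ℂ) = 1 / 2 + 2 * t * I := by ring
  rw [e] at this
  exact this

lemma norm_phase (φ : ℝ) : ‖cexp (-(φ / 4) * I)‖ = 1 := by
  rw [show (-(φ / 4 : ℂ)) = ((-(φ / 4) : ℝ) : ℂ) by push_cast; ring, norm_exp_ofReal_mul_I]

lemma Zc_bound {φ : ℝ} (h1 : 0 ≤ φ) (h2 : φ < π / 2) :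
    ∃ C : ℝ, ∀ t : ℝ, ‖Zc t‖ ≤ C * Real.exp (-(φ * |t|)) := by
  refine ⟨∫ x : ℝ in Ioi 0, ‖(x : ℂ) ^ ((1 / 4 : ℂ) - 1) • Hfun (cexp (φ * I)) x‖, ?_⟩
  have key : ∀ t : ℝ, ‖Zc t‖ ≤ (∫ x : ℝ in Ioi 0, ‖(x : ℂ) ^ ((1 / 4 : ℂ) - 1) • Hfun (cexp (φ * I)) x‖)
      * Real.exp (-(φ * t)) := by
    intro t
    have hm := (mellin_H_line (φ := φ) (by linarith [Real.pi_pos]) h2 t).2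
    have hle : ‖mellin (Hfun (cexp (φ * I))) (1 / 4 + t * I)‖ ≤
        ∫ x : ℝ in Ioi 0, ‖(x : ℂ) ^ ((1 / 4 : ℂ) - 1) • Hfun (cexp (φ * I)) x‖ := by
      rw [mellin]
      refine (norm_integral_le_integral_norm _).trans (le_of_eq ?_)
      refine setIntegral_congr_fun measurableSet_Ioi fun x hx => ?_
      simp only [norm_smul]
      rw [norm_cpow_eq_rpow_re_of_pos hx, norm_cpow_eq_rpow_re_of_pos hx]
      simp
    rw [hm, norm_mul, norm_mul, norm_mul, norm_phase, norm_real, Real.norm_eq_abs, Real.abs_exp] at hle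
    rw [Real.exp_neg, ← div_eq_mul_inv, le_div_iff₀ (Real.exp_pos _)]
    have : 0 ≤ Real.exp (φ * t) * ‖Zc t‖ := by positivity
    rw [Complex.norm_ofNat, one_mul] at hle
    linarith
  intro t
  rcases abs_cases t with ⟨h, _⟩ | ⟨h, _⟩
  · rw [h]; exact key t
  · rw [h, ← Zc_neg]; exact key (-t)

lemma integrable_Zc {φ : ℝ} (h1 : 0 ≤ φ) (h2 : φ < π / 2) :
    Integrable (fun t : ℝ => (Real.exp (φ * t) : ℂ) * Zc t) := by
  obtain ⟨ψ, hψ1, hψ2⟩ := exists_between h2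
  obtain ⟨C, hC⟩ := Zc_bound (h1.trans hψ1.le) hψ2
  have hIntg : Integrable (fun t : ℝ => Real.exp (-((ψ - φ) * |t|))) := by
    have hp : 0 < ψ - φ := by linarith
    rw [← integrableOn_univ, ← Iic_union_Ioi (a := (0:ℝ))]
    refine IntegrableOn.union ?_ ?_
    · refine (integrableOn_exp_mul_Iic hp 0).congr_fun (fun t ht => ?_) measurableSet_Iic
      simp only [abs_of_nonpos (show t ≤ 0 from ht)]; ring_nf
    · refine (integrableOn_exp_mul_Ioi (neg_lt_zero.2 hp) 0).congr_fun (fun t ht => ?_) measurableSet_Ioi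
      simp only [abs_of_pos (show 0 < t from ht)]; ring_nf
  refine (hIntg.const_mul C).mono' ?_ ?_
  · refine Continuous.aestronglyMeasurable ?_
    have := Zc_cont
    fun_prop
  · filter_upwards with t
    rw [norm_mul, norm_real, Real.norm_eq_abs, Real.abs_exp]
    have hC0 : 0 ≤ C := by
      have := (norm_nonneg _).trans (hC 0); simpa using this
    calc Real.exp (φ * t) * ‖Zc t‖ ≤ Real.exp (φ * |t|) * (C * Real.exp (-(ψ * |t|))) := by
          gcongr
          · exact le_abs_self t
          · exact hC t
      _ = C * Real.exp (-((ψ - φ) * |t|)) := by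
          rw [mul_left_comm, ← Real.exp_add]; ring_nf

lemma key_ineq (hreal : ∀ t, (Zc t).im = 0) (hne : ∀ t, Zc t ≠ 0) {φ : ℝ} (h1 : 0 ≤ φ)
    (h2 : φ < π / 2) {x : ℝ} (hx : 0 < x) :
    x ^ (1 / 4 : ℝ) * ‖Hfun (cexp (φ * I)) x‖ ≤ ‖Hfun (cexp (φ * I)) 1‖ := by
  have h1' : -(π / 2) < φ := by linarith [Real.pi_pos]
  have hw := cos_re h1' h2
  have hI := integrable_Zc h1 h2
  have hmel : ∀ t : ℝ, mellin (Hfun (cexp (φ * I))) (((1 / 4 : ℝ) : ℂ) + t * I) =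
      2 * (cexp (-(φ / 4) * I) * (Real.exp (φ * t) : ℝ) * Zc t) := by
    intro t
    have := (mellin_H_line h1' h2 t).2
    push_cast at this ⊢
    exact this
  have hinv : ∀ y : ℝ, 0 < y → Hfun (cexp (φ * I)) y = (1 / (2 * π) : ℝ) •
      ∫ t : ℝ, (y : ℂ) ^ (-((((1 / 4 : ℝ) : ℂ) + t * I))) •
        (2 * (cexp (-(φ / 4) * I) * (Real.exp (φ * t) : ℝ) * Zc t)) := by
    intro y hy
    rw [← mellinInv_mellin_eq (1 / 4) (Hfun (cexp (φ * I))) hy]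
    · rw [mellinInv]
      simp_rw [hmel]
    · have := (mellin_H_line h1' h2 0).1
      push_cast at this ⊢
      simpa using this
    · rw [VerticalIntegrable]
      simp_rw [hmel]
      refine ((hI.const_mul (2 * cexp (-(φ / 4) * I)))).congr ?_
      filter_upwards with t
      ring
    · refine ((theta_cont hw hy).sub continuousAt_const).sub ?_
      refine continuousAt_const.mul ?_
      exact ContinuousAt.cpow (by fun_prop) (by fun_prop) (Or.inl (by simpa using hy))
  have hub : x ^ (1 / 4 : ℝ) * ‖Hfun (cexp (φ * I)) x‖ ≤
      (1 / (2 * π)) * ∫ t : ℝ, 2 * ‖(Real.exp (φ * t) : ℂ) * Zc t‖ := by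
    rw [hinv x hx, norm_smul, Real.norm_of_nonneg (by positivity), mul_left_comm]
    gcongr
    rw [← Real.norm_of_nonneg (Real.rpow_nonneg hx.le (1 / 4)), ← norm_smul, ← integral_smul]
    refine (norm_integral_le_integral_norm _).trans (le_of_eq ?_)
    congr 1
    ext t
    rw [norm_smul, norm_smul, norm_cpow_eq_rpow_re_of_pos hx, norm_mul, norm_mul, norm_mul,
      norm_phase, norm_mul, Real.norm_of_nonneg (Real.rpow_nonneg hx.le (1 / 4)), ← mul_assoc,
      ← Real.rpow_add hx]
    simp
  have hcont : Continuous fun t => (Zc t).re := Complex.continuous_re.comp Zc_cont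
  have hre : ∀ t, Zc t = ((Zc t).re : ℂ) := fun t => by
    apply Complex.ext <;> simp [hreal]
  have hsign : ∃ c : ℝ, |c| = 1 ∧ ∀ t, ‖Zc t‖ = c * (Zc t).re := by
    have hz : ∀ t, (Zc t).re ≠ 0 := fun t h => hne t (by rw [hre t, h]; simp)
    have : (∀ t, 0 < (Zc t).re) ∨ (∀ t, (Zc t).re < 0) := by
      by_contra hcon
      push Not at hcon
      obtain ⟨⟨a, ha⟩, ⟨b, hb⟩⟩ := hcon
      obtain ⟨c, hc⟩ := mem_range_of_exists_le_of_exists_ge hcont ⟨a, ha⟩ ⟨b, hb⟩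
      exact hz c hc
    rcases this with h | h
    · refine ⟨1, by simp, fun t => ?_⟩
      rw [hre t, norm_real, Real.norm_of_nonneg (h t).le]; simp
    · refine ⟨-1, by simp, fun t => ?_⟩
      rw [hre t, norm_real, Real.norm_of_nonpos (h t).le]; simp
  obtain ⟨c, hc1, hc⟩ := hsign
  have hone : ‖Hfun (cexp (φ * I)) 1‖ =
      (1 / (2 * π)) * ∫ t : ℝ, 2 * ‖(Real.exp (φ * t) : ℂ) * Zc t‖ := by
    have e1 : ∫ t : ℝ, ((1:ℝ) : ℂ) ^ (-((((1 / 4 : ℝ) : ℂ) + t * I))) •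
        (2 * (cexp (-(φ / 4) * I) * (Real.exp (φ * t) : ℝ) * Zc t)) =
        cexp (-(φ / 4) * I) * ((∫ t : ℝ, 2 * (Real.exp (φ * t) * (Zc t).re) : ℝ) : ℂ) := by
      rw [← integral_complex_ofReal, ← integral_const_mul]
      congr 1
      ext t
      rw [hre t]
      simp
      ring
    have e2 : ∫ t : ℝ, 2 * ‖(Real.exp (φ * t) : ℂ) * Zc t‖ =
        c * ∫ t : ℝ, 2 * (Real.exp (φ * t) * (Zc t).re) := by
      rw [← integral_const_mul]
      congr 1
      ext t
      rw [norm_mul, hc, norm_real, Real.norm_eq_abs, Real.abs_exp]; ring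
    have hnn : 0 ≤ ∫ t : ℝ, 2 * ‖(Real.exp (φ * t) : ℂ) * Zc t‖ :=
      integral_nonneg fun t => by positivity
    rw [hinv 1 one_pos, e1, norm_smul, norm_mul, norm_phase, one_mul, norm_real,
      Real.norm_of_nonneg (by positivity : (0:ℝ) ≤ 1 / (2 * π))]
    congr 1
    rw [← abs_of_nonneg hnn, e2, abs_mul, hc1, one_mul, Real.norm_eq_abs]
  rw [hone]
  exact hub


lemma theta_hasSum {τ : ℂ} (hτ : 0 < τ.im) :
    HasSum (fun n : ℤ => cexp (π * I * (n : ℂ) ^ 2 * τ)) (jacobiTheta τ) := by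
  have := hasSum_jacobiTheta₂_term 0 hτ
  rw [← jacobiTheta_eq_jacobiTheta₂] at this
  refine this.congr_fun ?_ |> fun h => h
  intro n
  simp [jacobiTheta₂_term]

lemma theta_one_add {τ : ℂ} (hτ : 0 < τ.im) :
    jacobiTheta (1 + τ) = 2 * jacobiTheta (4 * τ) - jacobiTheta τ := by
  have h1 := theta_hasSum (τ := 1 + τ) (by simpa using hτ)
  have h2 := theta_hasSum hτ
  have h4 := (theta_hasSum (τ := 4 * τ) (by simpa using hτ)).mul_left 2
  have hinj : Function.Injective (fun n : ℤ => 2 * n) := fun a b h => by simpa using h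
  have h5 : HasSum (fun n : ℤ => cexp (π * I * (n : ℂ) ^ 2 * (1 + τ)) + cexp (π * I * (n : ℂ) ^ 2 * τ))
      (2 * jacobiTheta (4 * τ)) := by
    have hexp : ∀ n : ℤ, cexp (π * I * (n : ℂ) ^ 2 * (1 + τ)) =
        (cexp (π * I)) ^ (n ^ 2) * cexp (π * I * (n : ℂ) ^ 2 * τ) := by
      intro n
      rw [← Complex.exp_int_mul, ← Complex.exp_add]
      congr 1
      push_cast; ring
    rw [← hinj.hasSum_iff]
    · refine h4.congr_fun ?_ |> fun h => h
      intro n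
      simp only [Function.comp, hexp]
      rw [exp_pi_mul_I, Even.neg_one_zpow ⟨2 * n ^ 2, by ring⟩]
      push_cast
      rw [show (π * I * (2 * (n:ℂ)) ^ 2 * τ) = π * I * (n:ℂ) ^ 2 * (4 * τ) by ring]
      ring
    · intro n hn
      have hodd : Odd n := by
        rcases Int.even_or_odd n with ⟨k, hk⟩ | h
        · exact absurd ⟨k, by simp [hk]; ring⟩ hn
        · exact h
      rw [hexp, exp_pi_mul_I, Odd.neg_one_zpow (hodd.pow)]
      ring
  have := (h1.add h2).unique h5
  linear_combination this

lemma theta_tail {τ : ℂ} (hτ : 20 ≤ τ.im) : ‖jacobiTheta τ - 1‖ ≤ 4 * (1 / 2) ^ 60 := by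
  have h := norm_jacobiTheta_sub_one_le (τ := τ) (by linarith)
  have hq : Real.exp (-π * τ.im) ≤ (1 / 2) ^ 60 := by
    have h1 : -π * τ.im ≤ -60 := by nlinarith [Real.pi_gt_three]
    have h2 : Real.exp (-1) ≤ 1 / 2 := by
      rw [Real.exp_neg, one_div]
      apply inv_anti₀ (by norm_num)
      have := Real.add_one_le_exp (1:ℝ)
      linarith
    calc Real.exp (-π * τ.im) ≤ Real.exp (-60) := Real.exp_le_exp.2 h1
      _ = Real.exp (-1) ^ 60 := by rw [← Real.exp_nat_mul]; norm_num
      _ ≤ _ := by gcongr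
  have h3 : 2 / (1 - Real.exp (-π * τ.im)) ≤ 4 := by
    have : Real.exp (-π * τ.im) ≤ 1 / 2 := hq.trans (by norm_num)
    rw [div_le_iff₀ (by linarith)]; linarith
  refine h.trans ?_
  gcongr

lemma theta_small {z : ℂ} (h1 : 1 / 1000 ≤ z.re) (h2 : 80 * normSq (z - I) ≤ z.re) :
    ‖jacobiTheta (I * z)‖ ≤ 1 / 10 ^ 10 := by
  set δ := z - I with hδ
  have hre : δ.re = z.re := by simp [hδ]
  have hδ0 : δ ≠ 0 := by intro h; rw [h] at hre; simp at hre; linarith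
  have hn : 0 < normSq δ := normSq_pos.2 hδ0
  have him : (I * (1 / δ)).im = z.re / normSq δ := by
    simp [inv_re, hre]
  have hbig : 80 ≤ z.re / normSq δ := by rw [le_div_iff₀ hn]; exact h2
  have e1 : jacobiTheta (I * z) = jacobiTheta (1 + I * δ) := by
    rw [← jacobiTheta_two_add]; congr 1
    rw [hδ]; linear_combination I_mul_I
  have hδim : 0 < (I * δ).im := by simp [hre]; linarith
  have f1 := theta_feq (I * δ) hδim
  have f2 := theta_feq (4 * (I * δ)) (by simpa using hδim)
  have a1 : -1 / (I * δ) = I * (1 / δ) := by field_simp; simp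
  have a2 : -1 / (4 * (I * δ)) = I * (1 / δ) / 4 := by field_simp; simp
  have a3 : -I * (I * δ) = δ := by linear_combination (-δ) * I_mul_I
  have a4 : -I * (4 * (I * δ)) = ((4:ℝ):ℂ) * δ := by push_cast; linear_combination (-4*δ) * I_mul_I
  have a5 : ((4:ℝ):ℂ) ^ (1 / 2 : ℂ) = 2 := by
    rw [show (1 / 2 : ℂ) = ((1 / 2 : ℝ) : ℂ) by push_cast; rfl, ← ofReal_cpow (by norm_num),
      ← Real.sqrt_eq_rpow, show (4:ℝ) = 2 ^ 2 by norm_num, Real.sqrt_sq (by norm_num)]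
    simp
  rw [a1, a3] at f1
  rw [a2, a4, real_mul_cpow (by norm_num) hδ0, a5] at f2
  have f3 : δ ^ (1 / 2 : ℂ) * jacobiTheta (1 + I * δ) =
      (jacobiTheta (I * (1 / δ) / 4) - 1) - (jacobiTheta (I * (1 / δ)) - 1) := by
    rw [theta_one_add hδim, f1, f2]; ring
  have b1 := theta_tail (τ := I * (1 / δ) / 4) (by
    rw [Complex.div_ofNat_im, him]; linarith)
  have b2 := theta_tail (τ := I * (1 / δ)) (by rw [him]; linarith)
  have b3 : ‖δ ^ (1 / 2 : ℂ)‖ * ‖jacobiTheta (1 + I * δ)‖ ≤ 8 * (1 / 2) ^ 60 := by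
    rw [← norm_mul, f3]
    refine (norm_sub_le _ _).trans ?_
    linarith
  have b4 : 1 / 1000 ≤ ‖δ ^ (1 / 2 : ℂ)‖ := by
    have h : ‖δ ^ (1 / 2 : ℂ)‖ ^ 2 = ‖δ‖ := by
      rw [← norm_pow, ← cpow_nat_mul]; norm_num
    have h' : 1 / 1000 ≤ ‖δ‖ := (h1.trans_eq hre.symm).trans (re_le_norm δ)
    by_contra hc
    push Not at hc
    have := norm_nonneg (δ ^ (1 / 2 : ℂ))
    nlinarith
  rw [e1]
  have := norm_nonneg (jacobiTheta (1 + I * δ))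
  have b5 : 1 / 1000 * ‖jacobiTheta (1 + I * δ)‖ ≤ 8 * (1 / 2) ^ 60 :=
    (mul_le_mul_of_nonneg_right b4 this).trans b3
  norm_num at b5 ⊢
  linarith

lemma numeric_contra {w : ℂ} (hwn : ‖w‖ = 1) (hw : 0 < w.re) {y : ℝ} (hy : 1 < y) (hy2 : y < 2)
    (hd : 1 / 10 ^ 7 ≤ (y - 1 / y) ^ 2)
    (hA : ‖jacobiTheta (I * w * ((y ^ 4 : ℝ) : ℂ))‖ ≤ 1 / 10 ^ 10)
    (hB : ‖jacobiTheta (I * w * ((1 : ℝ) : ℂ))‖ ≤ 1 / 10 ^ 10)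
    (h : (y ^ 4) ^ (1 / 4 : ℝ) * ‖Hfun w (y ^ 4)‖ ≤ ‖Hfun w 1‖) : False := by
  have hy0 : 0 < y := by linarith
  have hw0 : w ≠ 0 := by rintro rfl; simp at hw
  set c : ℂ := (1 / w) ^ (1 / 2 : ℂ) with hc
  have hcn : ‖c‖ = 1 := by
    have h : ‖c‖ ^ 2 = 1 := by
      rw [← norm_pow, hc, ← cpow_nat_mul]; norm_num [hwn]
    exact (pow_eq_one_iff_of_nonneg (norm_nonneg _) two_ne_zero).1 h
  have e1 : (y ^ 4) ^ (1 / 4 : ℝ) = y := by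
    rw [show (1 / 4 : ℝ) = ((4 : ℕ) : ℝ)⁻¹ by norm_num, Real.pow_rpow_inv_natCast hy0.le (by norm_num)]
  have e2 : ((y ^ 4 : ℝ) : ℂ) ^ (-(1 / 2) : ℂ) = ((1 / y ^ 2 : ℝ) : ℂ) := by
    rw [show (-(1 / 2) : ℂ) = ((-(1 / 2) : ℝ) : ℂ) by push_cast; rfl, ← ofReal_cpow (by positivity),
      Real.rpow_neg (by positivity), ← Real.sqrt_eq_rpow, show y ^ 4 = (y ^ 2) ^ 2 by ring,
      Real.sqrt_sq (by positivity), one_div]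
  set θ1 := jacobiTheta (I * w * ((y ^ 4 : ℝ) : ℂ))
  set θ0 := jacobiTheta (I * w * ((1 : ℝ) : ℂ))
  have g1 : ‖(y : ℂ) + c * ((1 / y : ℝ) : ℂ)‖ ≤ y * ‖Hfun w (y ^ 4)‖ + y * ‖θ1‖ := by
    have : (y : ℂ) + c * ((1 / y : ℝ) : ℂ) = (y : ℂ) * (θ1 - Hfun w (y ^ 4)) := by
      rw [Hfun, e2]; push_cast
      have : (y : ℂ) ≠ 0 := by exact_mod_cast hy0.ne'
      simp only [θ1, hc]; push_cast; field_simp; ring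
    rw [this, norm_mul, norm_real, Real.norm_of_nonneg hy0.le, ← mul_add]
    gcongr
    rw [add_comm]
    exact norm_sub_le _ _
  have g0 : ‖Hfun w 1‖ ≤ ‖1 + c‖ + ‖θ0‖ := by
    have : Hfun w 1 = θ0 - (1 + c) := by
      rw [Hfun]; simp only [θ0, hc]; simp; ring
    rw [this]
    exact (norm_sub_le _ _).trans (le_of_eq (add_comm _ _))
  rw [e1] at h
  have hcre : normSq c = 1 := by rw [normSq_eq_norm_sq, hcn]; norm_num
  rw [normSq_apply] at hcre
  have n1 : ‖(y : ℂ) + c * ((1 / y : ℝ) : ℂ)‖ ^ 2 = ‖1 + c‖ ^ 2 + (y - 1 / y) ^ 2 := by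
    rw [← normSq_eq_norm_sq, ← normSq_eq_norm_sq, normSq_apply, normSq_apply]
    simp only [add_re, add_im, ofReal_re, ofReal_im, re_mul_ofReal, im_mul_ofReal, one_re, one_im]
    field_simp
    linear_combination (1 - y ^ 2) * hcre
  have n2 : ‖1 + c‖ ≤ 2 := (norm_add_le _ _).trans (by rw [hcn]; norm_num)
  set A := ‖(y : ℂ) + c * ((1 / y : ℝ) : ℂ)‖
  set B := ‖1 + c‖
  have hB0 : 0 ≤ B := norm_nonneg _
  have hA0 : 0 ≤ A := norm_nonneg _
  have hAB : A ≤ B + 3 / 10 ^ 10 := by nlinarith [norm_nonneg θ1]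
  have hd' : 1 / 10 ^ 7 ≤ A ^ 2 - B ^ 2 := by linarith
  have hsq : A ^ 2 ≤ (B + 3 / 10 ^ 10) ^ 2 := pow_le_pow_left₀ hA0 hAB 2
  have hexp : (B + 3 / 10 ^ 10) ^ 2 = B ^ 2 + 6 / 10 ^ 10 * B + 9 / 10 ^ 20 := by ring
  rw [hexp] at hsq
  norm_num at hd' hsq
  linarith

lemma Zc_conj (t : ℝ) : (Zc t).im = 0 := by
  have hG : ∀ s : ℂ, Gammaℝ ((starRingEnd ℂ) s) = (starRingEnd ℂ) (Gammaℝ s) := by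
    intro s
    rw [Gammaℝ_def, Gammaℝ_def, map_mul, ← Complex.Gamma_conj, map_div₀, Complex.conj_ofNat]
    congr 1
    have : (starRingEnd ℂ) ((π:ℂ) ^ (-s / 2)) = (π:ℂ) ^ ((starRingEnd ℂ) (-s / 2)) := by
      rw [cpow_conj _ _ (by rw [arg_ofReal_of_nonneg Real.pi_pos.le]; exact Real.pi_pos.ne), conj_ofReal]
    have h2 : (starRingEnd ℂ) (2 : ℂ) = 2 := map_ofNat _ 2
    rw [this, map_div₀, map_neg, h2]
  have hL : ∀ s : ℂ, 0 < s.re → completedRiemannZeta s = riemannZeta s * Gammaℝ s := by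
    intro s hs
    have h0 : s ≠ 0 := by rintro rfl; simp at hs
    rw [riemannZeta_def_of_ne_zero h0, div_mul_cancel₀ _ (Gammaℝ_ne_zero_of_re_pos hs)]
  rw [← conj_eq_iff_im]
  have h1 : 0 < (1 / 2 + 2 * t * I : ℂ).re := by norm_num
  have : (starRingEnd ℂ) (Zc t) = Zc (-t) := by
    have e : (1 / 2 + 2 * ((-t : ℝ) : ℂ) * I : ℂ) = (starRingEnd ℂ) (1 / 2 + 2 * t * I) := by
      have h2 : (starRingEnd ℂ) (2 : ℂ) = 2 := map_ofNat _ 2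
      simp [h2]
    rw [Zc, Zc, e, hL _ h1, hL _ (by rw [conj_re]; exact h1), riemannZeta_conj, hG, map_mul]
  rw [this, Zc_neg]

theorem zeta_has_zero_on_critical_line :
    ∃ t : ℝ, riemannZeta ((1 / 2 : ℂ) + t * Complex.I) = 0 := by
  by_contra hcon
  push Not at hcon
  have hne : ∀ t, Zc t ≠ 0 := by
    intro t h
    apply hcon (2 * t)
    rw [riemannZeta_def_of_ne_zero]
    · push_cast
      rw [Zc] at h
      rw [h, zero_div]
    · intro h; simpa using congrArg re h
  set w : ℂ := ⟨2000 / 1000001, 999999 / 1000001⟩ with hw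
  have hwre : 0 < w.re := by norm_num [hw]
  have hwn : ‖w‖ = 1 := by
    have : ‖w‖ ^ 2 = 1 := by
      rw [← normSq_eq_norm_sq, normSq_apply]; norm_num [hw]
    exact (pow_eq_one_iff_of_nonneg (norm_nonneg _) two_ne_zero).1 this
  have hwarg : cexp (arg w * I) = w := by
    have := norm_mul_exp_arg_mul_I w
    rwa [hwn, ofReal_one, one_mul] at this
  have ha1 : 0 ≤ arg w := arg_nonneg_iff.2 (by norm_num [hw])
  have ha2 : arg w < π / 2 := (abs_lt.1 (abs_arg_lt_pi_div_two_iff.2 (Or.inl hwre))).2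
  have key := key_ineq Zc_conj hne ha1 ha2 (x := (2001 / 2000 : ℝ) ^ 4) (by positivity)
  rw [hwarg] at key
  refine numeric_contra hwn hwre (y := 2001 / 2000) (by norm_num) (by norm_num) (by norm_num) ?_ ?_ key
  · rw [mul_assoc]
    apply theta_small
    · rw [re_mul_ofReal]; norm_num [hw]
    · rw [normSq_apply, sub_re, sub_im, re_mul_ofReal, im_mul_ofReal, I_re, I_im]; norm_num [hw]
  · rw [mul_assoc]
    apply theta_small
    · rw [re_mul_ofReal]; norm_num [hw]
    · rw [normSq_apply, sub_re, sub_im, re_mul_ofReal, im_mul_ofReal, I_re, I_im]; norm_num [hw]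
end
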